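/- arXiv:2102.08017 — 2 statements merged into one kernel-verified Lean document; each statement's English description precedes it below -/
import Mathlib

section
/- For any R > 0 and α ∈ [0, π/2), let u be the unique entire solution emanating from the planar front in the funnel-shaped domain Ω = Ω_{R,α}. If there exists a C²(Ω̄) function U with 0 < U ≤ 1 in Ω̄, ΔU + f(U) = 0 in Ω̄, ν·∇U = 0 on ∂Ω, and U(x) → 1 as x₁ → −∞, then u(t,x) ≤ U(x) for all (t,x) ∈ ℝ × Ω̄. -/
open Set Filter Topology MeasureTheory

noncomputable section

/-- `ℝ^N` with `N = d+1`, Euclidean structure. -/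
abbrev Euc (d : ℕ) := EuclideanSpace ℝ (Fin (d + 1))

/-- The Euclidean norm of `x' = (x₂,…,x_N)` for `x = (x₁,x') ∈ ℝ^N`. -/
def primeNorm {d : ℕ} (x : Euc d) : ℝ :=
  Real.sqrt (∑ i, if i = 0 then 0 else (x i) ^ 2)

/-- The funnel-shaped domain `Ω = {x : |x'| < h(x₁)}`. -/
def funnel (d : ℕ) (h : ℝ → ℝ) : Set (Euc d) := {x | primeNorm x < h (x 0)}

/-- The Laplacian of `g` at `x`, computed with derivatives taken within the set `s`. -/
def lapW {d : ℕ} (s : Set (Euc d)) (g : Euc d → ℝ) (x : Euc d) : ℝ :=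
  ∑ i, fderivWithin ℝ (fun y => fderivWithin ℝ g s y (EuclideanSpace.single i 1)) s x
      (EuclideanSpace.single i 1)

/-- The quantity `ν·∇g` at a boundary point `x` of the funnel domain `Ω_{R,α}`, where
`ν(x) = (1+h'(x₁)²)^{-1/2}·(-h'(x₁), x'/|x'|)` is the outward unit normal. -/
def neumannLHS {d : ℕ} (h : ℝ → ℝ) (g : Euc d → ℝ) (x : Euc d) : ℝ :=
  (Real.sqrt (1 + deriv h (x 0) ^ 2))⁻¹ *
    (-(deriv h (x 0)) * fderivWithin ℝ g (closure (funnel d h)) x (EuclideanSpace.single 0 1)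
      + ∑ i, if i = 0 then 0 else
          (x i / primeNorm x) *
            fderivWithin ℝ g (closure (funnel d h)) x (EuclideanSpace.single i 1))

/-- The bistable nonlinearity `f`, of class `C^{1,1}`, with positive mass, extended affinely
outside `[0,1]`. -/
structure Bistable (f : ℝ → ℝ) (θ : ℝ) : Prop where
  smooth : ContDiff ℝ 1 f
  lip_deriv : ∃ C : NNReal, LipschitzWith C (deriv f)
  f0 : f 0 = 0
  f1 : f 1 = 0
  df0 : deriv f 0 < 0
  df1 : deriv f 1 < 0
  θmem : θ ∈ Ioo (0 : ℝ) 1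
  neg : ∀ s ∈ Ioo (0 : ℝ) θ, f s < 0
  pos : ∀ s ∈ Ioo θ (1 : ℝ), 0 < f s
  dθ : 0 < deriv f θ
  mass : 0 < ∫ s in (0 : ℝ)..1, f s
  ext_neg : ∀ s < (0 : ℝ), f s = deriv f 0 * s
  ext_pos : ∀ s > (1 : ℝ), f s = deriv f 1 * (s - 1)

/-- The planar traveling front `φ(x₁ - ct)`: `φ'' + cφ' + f(φ) = 0`, `φ(-∞) = 1`,
`φ(+∞) = 0`, `0 < φ < 1`, `φ` decreasing, normalized by `φ(0) = θ`, with speed `c > 0`. -/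
structure PlanarFront (f : ℝ → ℝ) (θ c : ℝ) (φ : ℝ → ℝ) : Prop where
  cpos : 0 < c
  mem : ∀ z : ℝ, φ z ∈ Ioo (0 : ℝ) 1
  smooth : ContDiff ℝ 2 φ
  anti : StrictAnti φ
  ode : ∀ z : ℝ, deriv (deriv φ) z + c * deriv φ z + f (φ z) = 0
  lim_bot : Tendsto φ atBot (nhds 1)
  lim_top : Tendsto φ atTop (nhds 0)
  pin : φ 0 = θ

/-- `h : ℝ → ℝ` defines a funnel-shaped domain `Ω_{R,α}` (of dimension `N = d+1 ≥ 2`) with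
cylinder radius `R`, opening angle `α` and transition parameter `L`. -/
structure IsFunnel (d : ℕ) (R α L : ℝ) (h : ℝ → ℝ) : Prop where
  dpos : 1 ≤ d
  Rpos : 0 < R
  αmem : α ∈ Ico (0 : ℝ) (Real.pi / 2)
  RL : R < L
  smooth : ContDiff ℝ 2 h
  holder : ∃ β : NNReal, 0 < β ∧ (β : ℝ) < 1 ∧ ∃ C : NNReal, HolderWith C β (deriv (deriv h))
  deriv_nonneg : ∀ x : ℝ, 0 ≤ deriv h x
  deriv_le : ∀ x : ℝ, deriv h x ≤ Real.tan α
  left : ∀ x ≤ (0 : ℝ), h x = R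
  right : ∀ x : ℝ, L * Real.cos α ≤ x → h x = x * Real.tan α

/-- An entire solution of `u_t = Δu + f(u)` in `ℝ × Ω̄` (with values in `[0,1]`),
Neumann boundary condition `ν·∇u = 0` on `ℝ × ∂Ω`, emanating from the planar front
`φ(x₁ - ct)` as `t → -∞`. -/
structure IsEntireSolution (d : ℕ) (h f : ℝ → ℝ) (c : ℝ) (φ : ℝ → ℝ)
    (u : ℝ → Euc d → ℝ) : Prop where
  range01 : ∀ t : ℝ, ∀ x ∈ closure (funnel d h), u t x ∈ Icc (0 : ℝ) 1
  time_diff : ∀ x ∈ closure (funnel d h), Differentiable ℝ fun t => u t x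
  space_reg : ∀ t : ℝ, ContDiffOn ℝ 2 (u t) (closure (funnel d h))
  pde : ∀ t : ℝ, ∀ x ∈ closure (funnel d h),
      deriv (fun s => u s x) t = lapW (closure (funnel d h)) (u t) x + f (u t x)
  neumann : ∀ t : ℝ, ∀ x ∈ frontier (funnel d h), neumannLHS h (u t) x = 0
  past : ∀ ε > (0 : ℝ), ∃ T : ℝ, ∀ t ≤ T, ∀ x ∈ closure (funnel d h),
      |u t x - φ (x 0 - c * t)| ≤ ε

/-- Complete propagation: `u(t,x) → 1` as `t → +∞` locally uniformly in `x ∈ Ω̄`. -/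
def CompletePropagation (d : ℕ) (h : ℝ → ℝ) (u : ℝ → Euc d → ℝ) : Prop :=
  TendstoLocallyUniformlyOn u (fun _ => (1 : ℝ)) atTop (closure (funnel d h))

/-- Blocking: `u(t,·)` converges uniformly on `Ω̄`, as `t → +∞`, to a stationary solution
`u_∞` with `u_∞(x) → 0` as `x₁ → +∞`. -/
def Blocked (d : ℕ) (h f : ℝ → ℝ) (u : ℝ → Euc d → ℝ) : Prop :=
  ∃ uinf : Euc d → ℝ,
    TendstoUniformlyOn u uinf atTop (closure (funnel d h)) ∧
    ContDiffOn ℝ 2 uinf (closure (funnel d h)) ∧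
    (∀ x ∈ closure (funnel d h), lapW (closure (funnel d h)) uinf x + f (uinf x) = 0) ∧
    (∀ x ∈ frontier (funnel d h), neumannLHS h uinf x = 0) ∧
    (∀ ε > (0 : ℝ), ∃ A : ℝ, ∀ x ∈ closure (funnel d h), A ≤ x 0 → |uinf x| ≤ ε)

/-- Stability of a solution `U` of `ΔU + f(U) = 0` on `s̄`:
`∫_s (|∇ψ|² - f'(U)ψ²) ≥ 0` for all compactly supported `C¹` functions `ψ`. -/
def StableOn {d : ℕ} (s : Set (Euc d)) (f : ℝ → ℝ) (U : Euc d → ℝ) : Prop :=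
  ∀ ψ : Euc d → ℝ, ContDiff ℝ 1 ψ → HasCompactSupport ψ →
    0 ≤ ∫ x in s, (‖gradient ψ x‖ ^ 2 - deriv f (U x) * ψ x ^ 2)

lemma IsFunnel.monotone {d : ℕ} {R α L : ℝ} {h : ℝ → ℝ} (hΩ : IsFunnel d R α L h) :
    Monotone h :=
  monotone_of_deriv_nonneg (hΩ.smooth.differentiable (by norm_num)) hΩ.deriv_nonneg

lemma IsFunnel.pos {d : ℕ} {R α L : ℝ} {h : ℝ → ℝ} (hΩ : IsFunnel d R α L h) (x : ℝ) :
    0 < h x := by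
  rcases le_total x 0 with hx | hx
  · rw [hΩ.left x hx]; exact hΩ.Rpos
  · have h1 := hΩ.monotone hx
    rw [hΩ.left 0 le_rfl] at h1
    exact hΩ.Rpos.trans_le h1

lemma IsFunnel.mul_deriv_le {d : ℕ} {R α L : ℝ} {h : ℝ → ℝ} (hΩ : IsFunnel d R α L h) (x : ℝ) :
    x * deriv h x ≤ h x := by
  rcases le_total x 0 with hx | hx
  · exact (mul_nonpos_of_nonpos_of_nonneg hx (hΩ.deriv_nonneg x)).trans (hΩ.pos x).le
  · refine (mul_le_mul_of_nonneg_left (hΩ.deriv_le x) hx).trans ?_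
    rcases le_total (L * Real.cos α) x with hL | hL
    · rw [hΩ.right x hL]
    · have h1 := image_sub_le_mul_sub_of_deriv_le (hΩ.smooth.differentiable (by norm_num))
        hΩ.deriv_le hL
      rw [hΩ.right _ le_rfl] at h1
      linarith

lemma primeNorm_eq {d : ℕ} (x : Euc d) :
    primeNorm x = ‖x - x 0 • EuclideanSpace.single 0 (1 : ℝ)‖ := by
  rw [primeNorm, EuclideanSpace.norm_eq]
  congr 1
  refine Finset.sum_congr rfl fun i _ => ?_
  by_cases hi : i = 0
  · subst hi; simp
  · simp [hi]

lemma continuous_primeNorm {d : ℕ} : Continuous (primeNorm : Euc d → ℝ) := by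
  have : (primeNorm : Euc d → ℝ) = fun x => ‖x - x 0 • EuclideanSpace.single 0 (1 : ℝ)‖ :=
    funext primeNorm_eq
  rw [this]
  fun_prop

lemma convexOn_primeNorm {d : ℕ} : ConvexOn ℝ univ (primeNorm : Euc d → ℝ) := by
  refine ⟨convex_univ, fun x _ y _ a b ha hb _ => ?_⟩
  simp only [primeNorm_eq, smul_eq_mul]
  have : (a • x + b • y) - (a • x + b • y) 0 • EuclideanSpace.single 0 (1 : ℝ)
      = a • (x - x 0 • EuclideanSpace.single 0 (1 : ℝ))
        + b • (y - y 0 • EuclideanSpace.single 0 (1 : ℝ)) := by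
    simp only [PiLp.add_apply, PiLp.smul_apply, smul_eq_mul]
    module
  rw [this]
  refine (norm_add_le _ _).trans ?_
  rw [norm_smul, norm_smul, Real.norm_of_nonneg ha, Real.norm_of_nonneg hb]

lemma primeNorm_sub_smul {d : ℕ} (x : Euc d) {s : ℝ} (h1 : s ≤ 1) (a : ℝ) :
    primeNorm (x - s • (x - x 0 • EuclideanSpace.single 0 (1 : ℝ))
      + a • EuclideanSpace.single 0 (1 : ℝ)) = (1 - s) * primeNorm x := by
  rw [primeNorm_eq, primeNorm_eq x]
  rw [← Real.norm_of_nonneg (sub_nonneg.2 h1), ← norm_smul]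
  congr 1
  simp
  module

lemma isOpen_funnel {d : ℕ} {h : ℝ → ℝ} (hh : Continuous h) : IsOpen (funnel d h) :=
  isOpen_lt continuous_primeNorm (hh.comp (by fun_prop))

lemma IsFunnel.closure_eq {d : ℕ} {R α L : ℝ} {h : ℝ → ℝ} (hΩ : IsFunnel d R α L h) :
    closure (funnel d h) = {x | primeNorm x ≤ h (x 0)} := by
  have hc : Continuous h := hΩ.smooth.continuous
  apply Subset.antisymm
  · exact closure_minimal (fun x (hx : primeNorm x < h (x 0)) => hx.le)
      (isClosed_le continuous_primeNorm (hc.comp (by fun_prop)))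
  · intro x hx
    have ht : Tendsto (fun s : ℝ => x - s • (x - x 0 • EuclideanSpace.single 0 (1 : ℝ))
        + (0 : ℝ) • EuclideanSpace.single 0 (1 : ℝ)) (𝓝[>] 0) (𝓝 x) := by
      have : Continuous (fun s : ℝ => x - s • (x - x 0 • EuclideanSpace.single 0 (1 : ℝ))
        + (0 : ℝ) • EuclideanSpace.single 0 (1 : ℝ)) := by fun_prop
      have h2 := this.tendsto 0
      simp only [zero_smul, sub_zero, add_zero] at h2
      simpa using h2.mono_left nhdsWithin_le_nhds
    refine mem_closure_of_tendsto ht ?_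
    have : Ioo (0 : ℝ) 1 ∈ 𝓝[>] (0 : ℝ) := Ioo_mem_nhdsGT one_pos
    filter_upwards [this] with s hs
    rw [funnel, mem_ofPred_eq, primeNorm_sub_smul x hs.2.le]
    have h0 : (x - s • (x - x 0 • EuclideanSpace.single 0 (1 : ℝ))
        + (0 : ℝ) • EuclideanSpace.single 0 (1 : ℝ) : Euc d) 0 = x 0 := by simp
    rw [h0]
    have hp := hΩ.pos (x 0)
    have hx' : primeNorm x ≤ h (x 0) := hx
    nlinarith [hs.1, hs.2, mul_le_mul_of_nonneg_left hx' (sub_nonneg.2 hs.2.le)]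

lemma IsFunnel.mem_closure_of_le {d : ℕ} {R α L : ℝ} {h : ℝ → ℝ} (hΩ : IsFunnel d R α L h)
    {a : ℝ} {y : Euc d} (ha : a ≤ y 0) (hy : primeNorm y ≤ h a) : y ∈ closure (funnel d h) := by
  rw [hΩ.closure_eq]
  exact hy.trans (hΩ.monotone ha)

lemma convex_cylinder {d : ℕ} (a r : ℝ) : Convex ℝ {y : Euc d | a ≤ y 0 ∧ primeNorm y ≤ r} := by
  have h1 : Convex ℝ {y : Euc d | a ≤ y 0} :=
    convex_halfSpace_ge ⟨fun x y => by simp, fun c x => by simp⟩ a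
  have h2 := convexOn_primeNorm (d := d) |>.convex_le r
  simp only [mem_univ, true_and] at h2
  exact h1.inter h2

lemma IsFunnel.uniqueDiffOn {d : ℕ} {R α L : ℝ} {h : ℝ → ℝ} (hΩ : IsFunnel d R α L h) :
    UniqueDiffOn ℝ (closure (funnel d h)) := by
  intro x hx
  have hx' : primeNorm x ≤ h (x 0) := by rw [hΩ.closure_eq] at hx; exact hx
  have hsub : {y : Euc d | x 0 ≤ y 0 ∧ primeNorm y ≤ h (x 0)} ⊆ closure (funnel d h) :=
    fun y hy => hΩ.mem_closure_of_le hy.1 hy.2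
  refine UniqueDiffWithinAt.mono ?_ hsub
  refine uniqueDiffWithinAt_convex (convex_cylinder _ _) ?_ (subset_closure ⟨le_rfl, hx'⟩)
  refine ⟨(x 0 + 1) • EuclideanSpace.single 0 (1 : ℝ), ?_⟩
  rw [mem_interior]
  refine ⟨{y : Euc d | x 0 < y 0} ∩ {y : Euc d | primeNorm y < h (x 0)},
    fun y hy => ⟨le_of_lt hy.1, le_of_lt hy.2⟩, ?_, ?_, ?_⟩
  · exact (isOpen_lt (by fun_prop) (by fun_prop)).inter
      (isOpen_lt continuous_primeNorm continuous_const)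
  · simp
  · simp only [mem_ofPred_eq, primeNorm_eq]
    simpa using hΩ.pos (x 0)

/-- A point of the closed funnel outside the open funnel lies on the frontier. -/
lemma IsFunnel.mem_frontier {d : ℕ} {R α L : ℝ} {h : ℝ → ℝ} (hΩ : IsFunnel d R α L h)
    {x : Euc d} (hx : x ∈ closure (funnel d h)) (hx' : x ∉ funnel d h) :
    x ∈ frontier (funnel d h) ∧ primeNorm x = h (x 0) := by
  refine ⟨?_, le_antisymm ?_ (not_lt.1 hx')⟩
  · rw [(isOpen_funnel hΩ.smooth.continuous).frontier_eq]; exact ⟨hx, hx'⟩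
  · rw [hΩ.closure_eq] at hx; exact hx

/-- The inward direction, a positive multiple of `-ν`. -/
def inward {d : ℕ} (h : ℝ → ℝ) (x : Euc d) : Euc d :=
  deriv h (x 0) • EuclideanSpace.single 0 (1 : ℝ)
    - (primeNorm x)⁻¹ • (x - x 0 • EuclideanSpace.single 0 (1 : ℝ))

lemma neumannLHS_eq {d : ℕ} (h : ℝ → ℝ) (g : Euc d → ℝ) (x : Euc d) :
    neumannLHS h g x = -((Real.sqrt (1 + deriv h (x 0) ^ 2))⁻¹ *
      fderivWithin ℝ g (closure (funnel d h)) x (inward h x)) := by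
  rw [neumannLHS, ← mul_neg]
  congr 1
  set F := fderivWithin ℝ g (closure (funnel d h)) x with hF
  have hx : x - x 0 • EuclideanSpace.single 0 (1 : ℝ)
      = ∑ i, (if i = 0 then 0 else x i) • EuclideanSpace.single i (1 : ℝ) := by
    ext j
    by_cases hj : j = 0
    · subst hj
      simp only [WithLp.ofLp_sum, Finset.sum_apply, PiLp.smul_apply, PiLp.sub_apply]
      simp
    · simp only [WithLp.ofLp_sum, Finset.sum_apply, PiLp.smul_apply, PiLp.sub_apply]
      simp [hj]
  rw [inward, hx, map_sub, map_smul, map_smul, map_sum]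
  simp only [map_smul, smul_eq_mul, Finset.mul_sum]
  rw [neg_sub, sub_eq_neg_add, neg_mul]
  congr 1
  refine Finset.sum_congr rfl fun i _ => ?_
  by_cases hi : i = 0
  · simp [hi]
  · simp [hi]; ring

lemma IsFunnel.segment_inward {d : ℕ} {R α L : ℝ} {h : ℝ → ℝ} (hΩ : IsFunnel d R α L h)
    {x : Euc d} (hx : primeNorm x = h (x 0)) {s : ℝ} (hs : 0 ≤ s) (hs' : s ≤ h (x 0)) :
    x + s • inward h x ∈ closure (funnel d h) := by
  have hp := hΩ.pos (x 0)
  have he : x + s • inward h x = x - (s * (primeNorm x)⁻¹) •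
      (x - x 0 • EuclideanSpace.single 0 (1 : ℝ))
      + (s * deriv h (x 0)) • EuclideanSpace.single 0 (1 : ℝ) := by
    rw [inward]; module
  have h1 : s * (primeNorm x)⁻¹ ≤ 1 := by
    rw [hx, ← div_eq_mul_inv, div_le_one hp]; exact hs'
  have h2 : 0 ≤ s * (primeNorm x)⁻¹ := by rw [hx]; positivity
  have h3 : 0 ≤ s * deriv h (x 0) := mul_nonneg hs (hΩ.deriv_nonneg _)
  apply hΩ.mem_closure_of_le (a := x 0)
  · rw [he]; simp; exact h3
  · rw [he, primeNorm_sub_smul x h1, hx]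
    nlinarith [hx ▸ h2]

lemma IsFunnel.inward_mem {d : ℕ} {R α L : ℝ} {h : ℝ → ℝ} (hΩ : IsFunnel d R α L h)
    {x : Euc d} (hx : primeNorm x = h (x 0)) :
    inward h x ∈ posTangentConeAt (closure (funnel d h)) x := by
  apply mem_posTangentConeAt_of_frequently_mem
  apply Eventually.frequently
  filter_upwards [Ioc_mem_nhdsGT (hΩ.pos (x 0))] with s hs
  exact hΩ.segment_inward hx hs.1.le hs.2

lemma second_deriv_nonpos_of_isLocalMax {φ φ₁ : ℝ → ℝ} {A : ℝ}
    (h1 : ∀ᶠ s in 𝓝 (0 : ℝ), HasDerivAt φ (φ₁ s) s) (h2 : HasDerivAt φ₁ A 0)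
    (hmax : IsLocalMax φ 0) : A ≤ 0 := by
  by_contra! hA
  have hd : deriv φ =ᶠ[𝓝 0] φ₁ := h1.mono fun s hs => hs.deriv
  have hdd : deriv (deriv φ) 0 = A := by rw [hd.deriv_eq, h2.deriv]
  have hmin : IsLocalMin φ 0 :=
    isLocalMin_of_deriv_deriv_pos (by rw [hdd]; exact hA) hmax.deriv_eq_zero
      h1.self_of_nhds.continuousAt
  have hconst : φ =ᶠ[𝓝 0] fun _ => φ 0 := by
    filter_upwards [hmin, hmax] with s a b using le_antisymm b a
  have h3 : deriv (deriv φ) 0 = 0 := by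
    have := hconst.deriv
    rw [this.deriv_eq]
    simp
  linarith

/-- A proper function on the closed funnel with positive outward normal derivative. -/
def weight {d : ℕ} (x : Euc d) : ℝ := ‖x‖ ^ 2 - x 0 + 1

lemma contDiff_weight {d : ℕ} : ContDiff ℝ 2 (weight : Euc d → ℝ) := by
  exact ((contDiff_norm_sq ℝ).sub (by fun_prop)).add contDiff_const

lemma norm_le_of_weight_le {d : ℕ} {x : Euc d} {ρ : ℝ} (hx : weight x ≤ ρ) : ‖x‖ ≤ |ρ| + 1 := by
  have h0 : x 0 ≤ ‖x‖ := (le_abs_self _).trans (by simpa using PiLp.norm_apply_le x 0)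
  have h1 := le_abs_self ρ
  have h2 := abs_nonneg ρ
  unfold weight at hx
  by_contra! h3
  nlinarith

/-- The part of the closed funnel where the weight is at most `ρ`. -/
def truncation (d : ℕ) (h : ℝ → ℝ) (ρ : ℝ) : Set (Euc d) := closure (funnel d h) ∩ {x | weight x ≤ ρ}

lemma isCompact_truncation (d : ℕ) (h : ℝ → ℝ) (ρ : ℝ) : IsCompact (truncation d h ρ) := by
  refine Metric.isCompact_of_isClosed_isBounded
    (isClosed_closure.inter (isClosed_le contDiff_weight.continuous continuous_const)) ?_
  refine isBounded_iff_forall_norm_le.2 ⟨|ρ| + 1, fun x hx => norm_le_of_weight_le hx.2⟩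

lemma weight_line {d : ℕ} (x : Euc d) (i : Fin (d + 1)) (s : ℝ) :
    weight (x + s • EuclideanSpace.single i (1 : ℝ))
      = weight x + s * (2 * x i - if i = 0 then 1 else 0) + s ^ 2 := by
  unfold weight
  rw [norm_add_sq_real, norm_smul]
  by_cases hi : i = 0
  · subst hi
    simp [inner_smul_right, EuclideanSpace.inner_single_right]
    ring
  · simp [inner_smul_right, EuclideanSpace.inner_single_right, hi, Ne.symm hi]
    ring

lemma hasFDerivAt_weight {d : ℕ} (x : Euc d) :
    HasFDerivAt weight (2 • (innerSL ℝ x) - (EuclideanSpace.proj 0 : Euc d →L[ℝ] ℝ)) x := by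
  unfold weight
  have h1 : HasFDerivAt (fun y : Euc d => ‖y‖ ^ 2) (2 • (innerSL ℝ x)) x := by
    exact (hasStrictFDerivAt_norm_sq x).hasFDerivAt
  have h2 : HasFDerivAt (fun y : Euc d => y 0) (EuclideanSpace.proj 0 : Euc d →L[ℝ] ℝ) x :=
    (EuclideanSpace.proj 0 : Euc d →L[ℝ] ℝ).hasFDerivAt
  exact (h1.sub h2).add_const 1

lemma IsFunnel.fderiv_weight_inward_neg {d : ℕ} {R α L : ℝ} {h : ℝ → ℝ}
    (hΩ : IsFunnel d R α L h) {x : Euc d} (hx : primeNorm x = h (x 0)) :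
    (2 • (innerSL ℝ x) - (EuclideanSpace.proj 0 : Euc d →L[ℝ] ℝ)) (inward h x) < 0 := by
  have hp := hΩ.pos (x 0)
  set P : Euc d := x - x 0 • EuclideanSpace.single 0 (1 : ℝ) with hP
  have hP0 : P 0 = 0 := by simp [hP]
  have hxP : inner ℝ x P = h (x 0) ^ 2 := by
    have h1 : x = P + x 0 • EuclideanSpace.single 0 (1 : ℝ) := by rw [hP]; module
    have h2 : inner ℝ x P = inner ℝ (P + x 0 • EuclideanSpace.single 0 (1 : ℝ)) P := by
      rw [← h1]
    rw [h2, inner_add_left, real_inner_self_eq_norm_sq, hP, ← primeNorm_eq, hx, ← hP,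
      inner_smul_left, EuclideanSpace.inner_single_left, hP0]
    simp
  have hval : (2 • (innerSL ℝ x) - (EuclideanSpace.proj 0 : Euc d →L[ℝ] ℝ)) (inward h x)
      = 2 * (x 0 * deriv h (x 0) - h (x 0)) - deriv h (x 0) := by
    have h3 : inner ℝ x (inward h x) = x 0 * deriv h (x 0) - h (x 0) := by
      rw [inward, ← hP, inner_sub_right, inner_smul_right, inner_smul_right, hxP, hx,
        EuclideanSpace.inner_single_right]
      simp
      field_simp
    have h4 : (inward h x) 0 = deriv h (x 0) := by
      rw [inward, ← hP]; simp [hP0]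
    simp [h3, h4]
  rw [hval]
  have h5 := hΩ.mul_deriv_le (x 0)
  have h6 := hΩ.deriv_nonneg (x 0)
  rcases h6.eq_or_lt with h7 | h7
  · rw [← h7]; linarith
  · linarith

lemma hasDerivAt_along {d : ℕ} {h : ℝ → ℝ} (hh : Continuous h) {v : Euc d → ℝ}
    (hv : DifferentiableOn ℝ v (closure (funnel d h))) {x e : Euc d} {s : ℝ}
    (hs : x + s • e ∈ funnel d h) :
    HasDerivAt (fun r : ℝ => v (x + r • e))
      (fderivWithin ℝ v (closure (funnel d h)) (x + s • e) e) s := by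
  have hnhds : closure (funnel d h) ∈ 𝓝 (x + s • e) :=
    mem_of_superset ((isOpen_funnel hh).mem_nhds hs) subset_closure
  have h1 : HasFDerivAt v (fderivWithin ℝ v (closure (funnel d h)) (x + s • e)) (x + s • e) :=
    ((hv _ (subset_closure hs)).hasFDerivWithinAt).hasFDerivAt hnhds
  have h2 : HasDerivAt (fun r : ℝ => x + r • e) e s := by
    simpa using ((hasDerivAt_id s).smul_const e).const_add x
  exact h1.comp_hasDerivAt s h2

lemma IsFunnel.differentiableOn_partial {d : ℕ} {R α L : ℝ} {h : ℝ → ℝ}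
    (hΩ : IsFunnel d R α L h) {v : Euc d → ℝ} (hv : ContDiffOn ℝ 2 v (closure (funnel d h)))
    (e : Euc d) : ContDiffOn ℝ 1 (fun y => fderivWithin ℝ v (closure (funnel d h)) y e)
      (closure (funnel d h)) :=
  (hv.fderivWithin hΩ.uniqueDiffOn (by norm_num)).clm_apply contDiffOn_const

lemma eventually_mem_funnel_line {d : ℕ} {h : ℝ → ℝ} (hh : Continuous h) {x : Euc d}
    (hx : x ∈ funnel d h) (e : Euc d) : ∀ᶠ s in 𝓝 (0 : ℝ), x + s • e ∈ funnel d h := by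
  have hc : ContinuousAt (fun s : ℝ => x + s • e) 0 := by fun_prop
  exact hc.preimage_mem_nhds ((isOpen_funnel hh).mem_nhds (by simpa using hx))

/-- First and second order conditions at a local maximum of `v - ψ ∘ weight`. -/
lemma IsFunnel.lapW_le_of_isLocalMaxOn {d : ℕ} {R α L : ℝ} {h : ℝ → ℝ}
    (hΩ : IsFunnel d R α L h) {v : Euc d → ℝ} (hv : ContDiffOn ℝ 2 v (closure (funnel d h)))
    (hn : ∀ x ∈ frontier (funnel d h), neumannLHS h v x = 0) {ψ ψ₁ ψ₂ : ℝ → ℝ}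
    (h1 : ∀ y, HasDerivAt ψ (ψ₁ y) y) (h2 : ∀ y, HasDerivAt ψ₁ (ψ₂ y) y) (hpos : ∀ y, 0 < ψ₁ y)
    {x : Euc d} (hx : x ∈ closure (funnel d h))
    (hmax : IsLocalMaxOn (fun y => v y - ψ (weight y)) (closure (funnel d h)) x) :
    x ∈ funnel d h ∧ lapW (closure (funnel d h)) v x ≤
      ∑ i, (ψ₂ (weight x) * (2 * x i - if i = 0 then 1 else 0) ^ 2 + ψ₁ (weight x) * 2) := by
  have hh := hΩ.smooth.continuous
  have hvd : DifferentiableOn ℝ v (closure (funnel d h)) := hv.differentiableOn (by norm_num)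
  have hxΩ : x ∈ funnel d h := by
    by_contra hxn
    obtain ⟨hfr, hpx⟩ := hΩ.mem_frontier hx hxn
    have hz : HasFDerivWithinAt (fun y => v y - ψ (weight y))
        (fderivWithin ℝ v (closure (funnel d h)) x - ψ₁ (weight x) •
          (2 • (innerSL ℝ x) - (EuclideanSpace.proj 0 : Euc d →L[ℝ] ℝ)))
        (closure (funnel d h)) x :=
      (hvd x hx).hasFDerivWithinAt.sub
        ((h1 (weight x)).comp_hasFDerivAt x (hasFDerivAt_weight x)).hasFDerivWithinAt
    have hle := hmax.hasFDerivWithinAt_nonpos hz (hΩ.inward_mem hpx)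
    have hneg := hΩ.fderiv_weight_inward_neg hpx
    have hnz := hn x hfr
    rw [neumannLHS_eq, neg_eq_zero, mul_eq_zero] at hnz
    have h0 : fderivWithin ℝ v (closure (funnel d h)) x (inward h x) = 0 := by
      refine hnz.resolve_left (inv_ne_zero (Real.sqrt_ne_zero'.2 (by positivity)))
    have heq : (fderivWithin ℝ v (closure (funnel d h)) x - ψ₁ (weight x) •
          (2 • (innerSL ℝ x) - (EuclideanSpace.proj 0 : Euc d →L[ℝ] ℝ))) (inward h x)
        = - (ψ₁ (weight x) *
          (2 • (innerSL ℝ x) - (EuclideanSpace.proj 0 : Euc d →L[ℝ] ℝ)) (inward h x)) := by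
      rw [sub_apply, smul_apply, h0, zero_sub, smul_eq_mul]
    rw [heq] at hle
    nlinarith [mul_neg_of_pos_of_neg (hpos (weight x)) hneg]
  refine ⟨hxΩ, ?_⟩
  rw [lapW]
  refine Finset.sum_le_sum fun i _ => ?_
  set e : Euc d := EuclideanSpace.single i (1 : ℝ) with he
  set β : ℝ := 2 * x i - if i = 0 then 1 else 0 with hβ
  have hev := eventually_mem_funnel_line hh hxΩ e
  have hl : ∀ s : ℝ, weight (x + s • e) = weight x + s * β + s ^ 2 := weight_line x i
  have hw : ∀ s : ℝ, HasDerivAt (fun r : ℝ => weight x + r * β + r ^ 2) (β + 2 * s) s := by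
    intro s
    have := (((hasDerivAt_id' s).mul_const β).const_add (weight x)).fun_add (hasDerivAt_pow 2 s)
    simpa using this
  have hw' : HasDerivAt (fun r : ℝ => β + 2 * r) 2 0 := by
    simpa using ((hasDerivAt_id (0 : ℝ)).const_mul 2).const_add β
  suffices hsuff : fderivWithin ℝ (fun y => fderivWithin ℝ v (closure (funnel d h)) y e)
      (closure (funnel d h)) (x + (0 : ℝ) • e) e - (ψ₂ (weight x) * β ^ 2 + ψ₁ (weight x) * 2) ≤ 0 by
    simp only [zero_smul, add_zero] at hsuff
    linarith
  refine second_deriv_nonpos_of_isLocalMax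
    (φ := fun s => v (x + s • e) - ψ (weight x + s * β + s ^ 2))
    (φ₁ := fun s => fderivWithin ℝ v (closure (funnel d h)) (x + s • e) e
      - ψ₁ (weight x + s * β + s ^ 2) * (β + 2 * s)) ?_ ?_ ?_
  · filter_upwards [hev] with s hs
    exact (hasDerivAt_along hh hvd hs).sub ((h1 _).comp s (hw s))
  · have hA := hasDerivAt_along hh
      ((hΩ.differentiableOn_partial hv e).differentiableOn (by norm_num)) (x := x) (e := e) (s := 0)
      (by simpa using hxΩ)
    have hB := ((h2 _).comp (0 : ℝ) (hw 0)).mul hw'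
    refine (hA.sub hB).congr_deriv ?_
    simp
    ring
  · have hc : Tendsto (fun s : ℝ => x + s • e) (𝓝 0) (𝓝[closure (funnel d h)] x) := by
      refine tendsto_nhdsWithin_iff.2 ⟨?_, hev.mono fun s hs => subset_closure hs⟩
      have : Continuous (fun s : ℝ => x + s • e) := by fun_prop
      simpa using this.tendsto 0
    filter_upwards [hc.eventually hmax] with s hs
    simp only [hl] at hs
    simpa using hs

lemma IsFunnel.lapW_add_mul {d : ℕ} {R α L : ℝ} {h : ℝ → ℝ} (hΩ : IsFunnel d R α L h)
    {v w : Euc d → ℝ} (hv : ContDiffOn ℝ 2 v (closure (funnel d h)))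
    (hw : ContDiffOn ℝ 2 w (closure (funnel d h))) (a b : ℝ) {x : Euc d}
    (hx : x ∈ closure (funnel d h)) :
    lapW (closure (funnel d h)) (fun y => a * v y + b * w y) x
      = a * lapW (closure (funnel d h)) v x + b * lapW (closure (funnel d h)) w x := by
  have key : ∀ {v w : Euc d → ℝ}, DifferentiableOn ℝ v (closure (funnel d h)) →
      DifferentiableOn ℝ w (closure (funnel d h)) → ∀ y ∈ closure (funnel d h), ∀ e : Euc d,
      fderivWithin ℝ (fun y => a * v y + b * w y) (closure (funnel d h)) y e
        = a * fderivWithin ℝ v (closure (funnel d h)) y e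
          + b * fderivWithin ℝ w (closure (funnel d h)) y e := by
    intro v w hv hw y hy e
    rw [(((hv y hy).hasFDerivWithinAt.const_mul a).fun_add
      ((hw y hy).hasFDerivWithinAt.const_mul b)).fderivWithin (hΩ.uniqueDiffOn y hy)]
    simp
  simp only [lapW, Finset.mul_sum, ← Finset.sum_add_distrib]
  refine Finset.sum_congr rfl fun i _ => ?_
  rw [fderivWithin_congr' (fun y hy => key (hv.differentiableOn (by norm_num))
    (hw.differentiableOn (by norm_num)) y hy _) hx]
  exact key ((hΩ.differentiableOn_partial hv _).differentiableOn (by norm_num))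
    ((hΩ.differentiableOn_partial hw _).differentiableOn (by norm_num)) x hx _

lemma IsFunnel.neumannLHS_add_mul {d : ℕ} {R α L : ℝ} {h : ℝ → ℝ} (hΩ : IsFunnel d R α L h)
    {v w : Euc d → ℝ} (hv : ContDiffOn ℝ 2 v (closure (funnel d h)))
    (hw : ContDiffOn ℝ 2 w (closure (funnel d h))) (a b : ℝ)
    (hvn : ∀ x ∈ frontier (funnel d h), neumannLHS h v x = 0)
    (hwn : ∀ x ∈ frontier (funnel d h), neumannLHS h w x = 0) :
    ∀ x ∈ frontier (funnel d h), neumannLHS h (fun y => a * v y + b * w y) x = 0 := by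
  intro x hx
  have hxc := frontier_subset_closure hx
  have hv' := hvn x hx
  have hw' := hwn x hx
  rw [neumannLHS_eq] at hv' hw' ⊢
  rw [((((hv.differentiableOn (by norm_num)) x hxc).hasFDerivWithinAt.const_mul a).fun_add
      (((hw.differentiableOn (by norm_num)) x hxc).hasFDerivWithinAt.const_mul b)).fderivWithin
        (hΩ.uniqueDiffOn x hxc)]
  simp only [add_apply, smul_apply, smul_eq_mul]
  linear_combination a * hv' + b * hw'

/-- If a sequence of continuous functions on a compact set is uniformly bounded and converges
pointwise to zero, then a convex set containing it contains functions bounded above by any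
positive constant. -/
lemma exists_mem_convex_forall_le {X : Type*} [TopologicalSpace X] [CompactSpace X] [T2Space X]
    {A : Set C(X, ℝ)} (hA : Convex ℝ A) {F : ℕ → C(X, ℝ)} (hF : ∀ n, F n ∈ A) {B : ℝ}
    (hB : ∀ n x, |F n x| ≤ B) (hlim : ∀ x, Tendsto (fun n => F n x) atTop (𝓝 0))
    {η : ℝ} (hη : 0 < η) : ∃ G ∈ A, ∀ x, G x ≤ η := by
  by_contra! hcon
  let _ : MeasurableSpace X := borel X
  have : BorelSpace X := ⟨rfl⟩
  set S : Set C(X, ℝ) := {g | ∀ x, g x < η} with hS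
  have hSo : IsOpen S := by
    have : S = {g : C(X, ℝ) | MapsTo g univ (Iio η)} := by
      ext g; simp [hS, MapsTo]
    rw [this]
    exact ContinuousMap.isOpen_setOfPred_mapsTo isCompact_univ isOpen_Iio
  have hSc : Convex ℝ S := by
    intro g hg k hk a b ha hb hab x
    have h1 : g x < η := hg x
    have h2 : k x < η := hk x
    have h3 : (a • g + b • k) x = a * g x + b * k x := by simp
    rw [h3]
    rcases ha.eq_or_lt with rfl | ha'
    · have : b = 1 := by linarith
      subst this; linarith
    · nlinarith [mul_lt_mul_of_pos_left h1 ha', mul_le_mul_of_nonneg_left h2.le hb]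
  have hdisj : Disjoint S A := by
    rw [Set.disjoint_left]
    intro g hg hgA
    obtain ⟨x, hx⟩ := hcon g hgA
    exact absurd (hg x) (not_lt.2 hx.le)
  obtain ⟨ℓ, s, hℓ1, hℓ2⟩ := geometric_hahn_banach_open hSc hSo hA hdisj
  have hs : 0 < s := by
    have := hℓ1 0 (fun x => by simpa using hη)
    simpa using this
  have hpos : ∀ g : C(X, ℝ), 0 ≤ g → 0 ≤ ℓ g := by
    intro g hg
    by_contra! hneg
    have hc : (0 : ℝ) ≤ s / (-ℓ g) := div_nonneg hs.le (by linarith)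
    have hm : (-(s / (-ℓ g))) • g ∈ S := by
      intro x
      have : 0 ≤ g x := hg x
      have h3 : ((-(s / (-ℓ g))) • g) x = -(s / (-ℓ g)) * g x := by simp
      rw [h3]
      nlinarith [mul_nonneg hc this]
    have h1 := hℓ1 _ hm
    rw [map_smul, smul_eq_mul] at h1
    have : -(s / (-ℓ g)) * ℓ g = s := by
      have := hneg.ne
      field_simp
    linarith
  let Λ : CompactlySupportedContinuousMap X ℝ →ₚ[ℝ] ℝ :=
    PositiveLinearMap.mk₀
      { toFun := fun g => ℓ g.toContinuousMap
        map_add' := fun g k => by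
          rw [← map_add]; rfl
        map_smul' := fun c g => by
          rw [RingHom.id_apply, ← map_smul]; rfl }
      (fun g hg => hpos _ hg)
  have hint : ∀ g : C(X, ℝ), ∫ x, g x ∂(RealRMK.rieszMeasure Λ) = ℓ g := by
    intro g
    have := RealRMK.integral_rieszMeasure Λ ⟨g, HasCompactSupport.of_compactSpace g⟩
    exact this
  have hfin : IsFiniteMeasure (RealRMK.rieszMeasure Λ) := by
    infer_instance
  have ht : Tendsto (fun n => ℓ (F n)) atTop (𝓝 0) := by
    simp only [← hint]
    have := tendsto_integral_of_dominated_convergence (μ := RealRMK.rieszMeasure Λ)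
      (F := fun n x => F n x) (f := fun _ => (0 : ℝ)) (fun _ => B)
      (fun n => (F n).continuous.aestronglyMeasurable) (integrable_const B)
      (fun n => Eventually.of_forall fun x => by simpa using hB n x)
      (Eventually.of_forall hlim)
    simpa using this
  have := ge_of_tendsto' ht (fun n => hℓ2 _ (hF n))
  linarith

/-- An abstract parabolic maximum principle on a compact set, for functions which are merely
upper semicontinuous from the right in time. -/
lemma forall_le_of_deriv_neg_at_max {X : Type*} [TopologicalSpace X] {K : Set X}
    (hK : IsCompact K) {q : ℝ → X → ℝ} {a b m : ℝ} (hab : a ≤ b)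
    (hcont : ∀ t ∈ Icc a b, ContinuousOn (q t) K)
    (hright : ∀ t ∈ Ico a b, ∀ ε > 0, ∀ᶠ s in 𝓝[>] t, ∀ x ∈ K, q s x ≤ q t x + ε)
    (hmax : ∀ t ∈ Ioc a b, ∀ x ∈ K, IsMaxOn (q t) K x → m < q t x →
      ∃ D < 0, HasDerivAt (fun s => q s x) D t)
    (hinit : ∀ x ∈ K, q a x ≤ m) : ∀ x ∈ K, q b x ≤ m := by
  by_contra! hcon
  obtain ⟨x₀, hx₀, hx₀m⟩ := hcon
  set μ := q b x₀ with hμ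
  set S : Set ℝ := {t | t ∈ Icc a b ∧ ∀ r ∈ Icc t b, ∃ x ∈ K, μ ≤ q r x} with hS
  have hbS : b ∈ S := by
    refine ⟨right_mem_Icc.2 hab, fun r hr => ⟨x₀, hx₀, ?_⟩⟩
    rw [le_antisymm hr.2 hr.1]
  have hbdd : BddBelow S := ⟨a, fun t ht => ht.1.1⟩
  set σ := sInf S with hσ
  have haσ : a ≤ σ := le_csInf ⟨b, hbS⟩ fun t ht => ht.1.1
  have hσb : σ ≤ b := csInf_le hbdd hbS
  have habove : ∀ r ∈ Ioc σ b, ∃ x ∈ K, μ ≤ q r x := by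
    intro r hr
    obtain ⟨t, ht, htr⟩ := exists_lt_of_csInf_lt ⟨b, hbS⟩ hr.1
    exact ht.2 r ⟨htr.le, hr.2⟩
  obtain ⟨xσ, hxσ, hmaxσ⟩ := hK.exists_isMaxOn ⟨x₀, hx₀⟩ (hcont σ ⟨haσ, hσb⟩)
  have hσμ : μ ≤ q σ xσ := by
    rcases hσb.eq_or_lt with h1 | h1
    · rw [h1] at hmaxσ ⊢
      exact hmaxσ hx₀
    · refine le_of_forall_pos_le_add fun ε hε => ?_
      have h2 := hright σ ⟨haσ, h1⟩ ε hε
      obtain ⟨s, hs1, hs2⟩ := (h2.and (Ioc_mem_nhdsGT h1)).exists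
      obtain ⟨x, hx, hxμ⟩ := habove s hs2
      have h3 : q σ x ≤ q σ xσ := hmaxσ hx
      linarith [hs1 x hx]
  have haσ' : a < σ := by
    refine haσ.lt_of_ne fun h1 => ?_
    have := hinit xσ hxσ
    rw [h1] at this
    linarith
  obtain ⟨D, hD, hder⟩ := hmax σ ⟨haσ', hσb⟩ xσ hxσ hmaxσ (by linarith)
  have hleft : ∀ᶠ s in 𝓝[<] σ, q σ xσ ≤ q s xσ := by
    have h1 := hasDerivAt_iff_tendsto_slope_left_right.1 hder |>.1
    filter_upwards [h1.eventually_lt_const hD, self_mem_nhdsWithin] with s hs hs'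
    rw [slope_def_field, div_neg_iff] at hs
    have : s - σ < 0 := sub_neg.2 hs'
    rcases hs with h | h <;> linarith [h.1, h.2]
  obtain ⟨l, hl, hl'⟩ := (mem_nhdsLT_iff_exists_Ioo_subset).1 hleft
  set t := max ((l + σ) / 2) a with ht
  have hlσ : l < σ := hl
  have htσ : t < σ := max_lt (by linarith) haσ'
  have htS : t ∈ S := by
    refine ⟨⟨le_max_right _ _, htσ.le.trans hσb⟩, fun r hr => ?_⟩
    rcases lt_trichotomy r σ with h1 | h1 | h1
    · refine ⟨xσ, hxσ, hσμ.trans (hl' ⟨?_, h1⟩)⟩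
      have := le_max_left ((l + σ) / 2) a
      linarith [hr.1]
    · exact ⟨xσ, hxσ, h1 ▸ hσμ⟩
    · exact habove r ⟨h1, hr.2⟩
  exact absurd (csInf_le hbdd htS) (not_le.2 htσ)

/-- Upper semicontinuity from the right in time, uniformly on the truncation at level `ρ`. -/
def RightUSC (d : ℕ) (h : ℝ → ℝ) (v : ℝ → Euc d → ℝ) (t ρ : ℝ) : Prop :=
  ∀ ε > 0, ∀ᶠ s in 𝓝[>] t, ∀ x ∈ truncation d h ρ, v s x ≤ v t x + ε

lemma RightUSC.mono {d : ℕ} {h : ℝ → ℝ} {v : ℝ → Euc d → ℝ} {t ρ ρ' : ℝ}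
    (hv : RightUSC d h v t ρ') (hρ : ρ ≤ ρ') : RightUSC d h v t ρ := fun ε hε =>
  (hv ε hε).mono fun _ hs x hx => hs x ⟨hx.1, le_trans hx.2 hρ⟩

/-- A Neumann subsolution of `v_t = Δv + M`, bounded above by one, on a time interval. -/
structure IsSubcurve (d : ℕ) (h : ℝ → ℝ) (M ρ a b : ℝ) (v : ℝ → Euc d → ℝ) : Prop where
  reg : ∀ t ∈ Icc a b, ContDiffOn ℝ 2 (v t) (closure (funnel d h))
  neumann : ∀ t ∈ Icc a b, ∀ x ∈ frontier (funnel d h), neumannLHS h (v t) x = 0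
  le_one : ∀ t ∈ Icc a b, ∀ x ∈ closure (funnel d h), v t x ≤ 1
  right : ∀ t ∈ Ico a b, RightUSC d h v t ρ
  hasDerivAt : ∀ t ∈ Icc a b, ∀ x ∈ closure (funnel d h),
    ∃ D ≤ lapW (closure (funnel d h)) (v t) x + M, HasDerivAt (fun s => v s x) D t

lemma IsFunnel.isSubcurve_combination {d : ℕ} {R α L : ℝ} {h : ℝ → ℝ} (hΩ : IsFunnel d R α L h)
    {M ρ a b : ℝ} {v w : ℝ → Euc d → ℝ} (hv : IsSubcurve d h M ρ a b v)
    (hw : IsSubcurve d h M ρ a b w) {p q : ℝ} (hp : 0 ≤ p) (hq : 0 ≤ q) (hpq : p + q = 1) :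
    IsSubcurve d h M ρ a b (fun t y => p * v t y + q * w t y) where
  reg t ht := (contDiffOn_const.mul (hv.reg t ht)).add (contDiffOn_const.mul (hw.reg t ht))
  neumann t ht := hΩ.neumannLHS_add_mul (hv.reg t ht) (hw.reg t ht) p q (hv.neumann t ht)
    (hw.neumann t ht)
  le_one t ht x hx := by
    nlinarith [hv.le_one t ht x hx, hw.le_one t ht x hx]
  right t ht ε hε := by
    filter_upwards [hv.right t ht ε hε, hw.right t ht ε hε] with s h1 h2 x hx
    nlinarith [mul_le_mul_of_nonneg_left (h1 x hx) hp, mul_le_mul_of_nonneg_left (h2 x hx) hq]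
  hasDerivAt t ht x hx := by
    obtain ⟨D, hD, hD'⟩ := hv.hasDerivAt t ht x hx
    obtain ⟨E, hE, hE'⟩ := hw.hasDerivAt t ht x hx
    refine ⟨p * D + q * E, ?_, (hD'.const_mul p).fun_add (hE'.const_mul q)⟩
    rw [hΩ.lapW_add_mul (hv.reg t ht) (hw.reg t ht) p q hx]
    have hpqM : p * M + q * M = M := by rw [← add_mul, hpq, one_mul]
    linarith [mul_le_mul_of_nonneg_left hD hp, mul_le_mul_of_nonneg_left hE hq]

lemma IsEntireSolution.isSubcurve_shift {d : ℕ} {h f φ : ℝ → ℝ} {c : ℝ} {u : ℝ → Euc d → ℝ}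
    (hu : IsEntireSolution d h f c φ u) {M : ℝ} (hM : ∀ y ∈ Icc (0 : ℝ) 1, f y ≤ M)
    {ρ a b s : ℝ} (hgood : ∀ t ∈ Ico (a + s) (b + s), RightUSC d h u t ρ) :
    IsSubcurve d h M ρ a b (fun t => u (t + s)) where
  reg t _ := hu.space_reg _
  neumann t _ := hu.neumann _
  le_one t _ x hx := (hu.range01 _ x hx).2
  right t ht ε hε := by
    have h1 := hgood (t + s) ⟨by linarith [ht.1], by linarith [ht.2]⟩ ε hε
    have h2 : Tendsto (fun r => r + s) (𝓝[>] t) (𝓝[>] (t + s)) := by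
      refine tendsto_nhdsWithin_iff.2 ⟨?_, ?_⟩
      · exact ((continuous_id.add continuous_const).tendsto t).mono_left nhdsWithin_le_nhds
      · filter_upwards [self_mem_nhdsWithin] with r hr
        have : t < r := hr
        exact add_lt_add_left this s
    exact h2.eventually h1
  hasDerivAt t _ x hx := by
    refine ⟨_, ?_, ((hu.time_diff x hx) (t + s)).hasDerivAt.comp_add_const t s⟩
    rw [hu.pde _ x hx]
    linarith [hM _ (hu.range01 (t + s) x hx)]

lemma isLocalMaxOn_of_isMaxOn_truncation {d : ℕ} {h : ℝ → ℝ} {ρ : ℝ} {q : Euc d → ℝ} {x : Euc d}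
    (hmax : IsMaxOn q (truncation d h ρ) x) (hx : weight x < ρ) :
    IsLocalMaxOn q (closure (funnel d h)) x := by
  have h1 : ∀ᶠ y in 𝓝[closure (funnel d h)] x, weight y < ρ :=
    (contDiff_weight.continuous.tendsto x |>.mono_left nhdsWithin_le_nhds).eventually_lt_const hx
  filter_upwards [h1, self_mem_nhdsWithin] with y hy hy'
  exact hmax ⟨hy', hy.le⟩

lemma IsSubcurve.le_add {d : ℕ} {R α L : ℝ} {h : ℝ → ℝ} (hΩ : IsFunnel d R α L h)
    {M ρ a b : ℝ} {v : ℝ → Euc d → ℝ} (hv : IsSubcurve d h M ρ a b v) (hab : a ≤ b)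
    {w : Euc d → ℝ} (hw : ContDiffOn ℝ 2 w (closure (funnel d h)))
    (hwn : ∀ x ∈ frontier (funnel d h), neumannLHS h w x = 0)
    (hw0 : ∀ x ∈ closure (funnel d h), 0 ≤ w x) {B C p η : ℝ}
    (hwC : ∀ x ∈ funnel d h, weight x < ρ → lapW (closure (funnel d h)) w x ≤ C) (hp : 0 < p)
    (hB : ∀ x ∈ truncation d h ρ, ∑ i, (p * (p * Real.exp (p * (weight x - ρ)))
      * (2 * x i - if i = 0 then 1 else 0) ^ 2 + p * Real.exp (p * (weight x - ρ)) * 2) ≤ B)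
    (hη : 0 ≤ η) (hC : 0 ≤ B + C + M + 1)
    (hinit : ∀ x ∈ truncation d h ρ, v a x ≤ w x + η) :
    ∀ x ∈ truncation d h ρ,
      v b x ≤ w x + Real.exp (p * (weight x - ρ)) + (B + C + M + 1) * (b - a) + η := by
  set κ := B + C + M + 1 with hκ
  have hψ : ∀ y, HasDerivAt (fun y => Real.exp (p * (y - ρ))) (p * Real.exp (p * (y - ρ))) y := by
    intro y
    have := (((hasDerivAt_id y).sub_const ρ).const_mul p).exp
    refine this.congr_deriv ?_
    simp; ring
  suffices hs : ∀ x ∈ truncation d h ρ,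
      v b x - w x - Real.exp (p * (weight x - ρ)) - κ * (b - a) ≤ η by
    intro x hx
    linarith [hs x hx]
  refine forall_le_of_deriv_neg_at_max
    (q := fun t x => v t x - w x - Real.exp (p * (weight x - ρ)) - κ * (t - a))
    (isCompact_truncation d h ρ) hab ?_ ?_ ?_ ?_
  · intro t ht
    have h1 : ContinuousOn (v t) (truncation d h ρ) :=
      (hv.reg t ht).continuousOn.mono inter_subset_left
    have h2 : ContinuousOn w (truncation d h ρ) := hw.continuousOn.mono inter_subset_left
    have h3 := (contDiff_weight (d := d)).continuous
    exact ((h1.sub h2).sub (Continuous.continuousOn (by fun_prop))).sub continuousOn_const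
  · intro t ht ε hε
    filter_upwards [hv.right t ht ε hε, self_mem_nhdsWithin] with s hs hts x hx
    have hts : t < s := hts
    nlinarith [hs x hx]
  · intro t ht x hx hmax hq
    have ht' : t ∈ Icc a b := ⟨ht.1.le, ht.2⟩
    have hxρ : weight x < ρ := by
      refine lt_of_le_of_ne hx.2 fun he => ?_
      have he : weight x = ρ := he
      rw [he] at hq
      simp only [sub_self, mul_zero, Real.exp_zero] at hq
      nlinarith [hv.le_one t ht' x hx.1, hw0 x hx.1, mul_nonneg hC (sub_nonneg.2 ht.1.le)]
    have hloc := isLocalMaxOn_of_isMaxOn_truncation hmax hxρ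
    have hloc' : IsLocalMaxOn (fun y => (1 * v t y + (-1) * w y)
        - Real.exp (p * (weight y - ρ))) (closure (funnel d h)) x := by
      filter_upwards [hloc] with y hy
      linarith
    obtain ⟨hxΩ, hlap⟩ := hΩ.lapW_le_of_isLocalMaxOn
      (ψ := fun y => Real.exp (p * (y - ρ))) (ψ₁ := fun y => p * Real.exp (p * (y - ρ)))
      (ψ₂ := fun y => p * (p * Real.exp (p * (y - ρ))))
      ((contDiffOn_const.mul (hv.reg t ht')).add (contDiffOn_const.mul hw))
      (hΩ.neumannLHS_add_mul (hv.reg t ht') hw 1 (-1) (hv.neumann t ht') hwn)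
      hψ (fun y => (hψ y).const_mul p) (fun y => by positivity) hx.1 hloc'
    rw [hΩ.lapW_add_mul (hv.reg t ht') hw 1 (-1) hx.1] at hlap
    obtain ⟨D, hD, hD'⟩ := hv.hasDerivAt t ht' x hx.1
    refine ⟨D - κ, ?_, ?_⟩
    · have := hB x hx
      have := hwC x hxΩ hxρ
      linarith
    · have := (((hD'.sub_const (w x)).sub_const (Real.exp (p * (weight x - ρ)))).fun_sub
        (((hasDerivAt_id' t).sub_const a).const_mul κ))
      simpa using this
  · intro x hx
    have := hinit x hx
    have := Real.exp_pos (p * (weight x - ρ))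
    simp only [sub_self, mul_zero]
    linarith

/-- Starting from a time with bounded Laplacian, a solution which is right upper semicontinuous
at all later times grows at a controlled rate. -/
lemma IsEntireSolution.le_add_of_rightUSC {d : ℕ} {R α L : ℝ} {h f φ : ℝ → ℝ} {c : ℝ}
    {u : ℝ → Euc d → ℝ} (hu : IsEntireSolution d h f c φ u) (hΩ : IsFunnel d R α L h)
    {M : ℝ} (hM : ∀ y ∈ Icc (0 : ℝ) 1, f y ≤ M) {ρ a b B C p : ℝ}
    (hgood : ∀ t ∈ Ioo a b, RightUSC d h u t ρ)
    (hwC : ∀ x ∈ funnel d h, weight x < ρ → lapW (closure (funnel d h)) (u a) x ≤ C) (hp : 0 < p)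
    (hB : ∀ x ∈ truncation d h ρ, ∑ i, (p * (p * Real.exp (p * (weight x - ρ)))
      * (2 * x i - if i = 0 then 1 else 0) ^ 2 + p * Real.exp (p * (weight x - ρ)) * 2) ≤ B)
    (hC : 0 ≤ B + C + M + 1) {t : ℝ} (ht : t ∈ Ioo a b) :
    ∀ x ∈ truncation d h ρ,
      u t x ≤ u a x + Real.exp (p * (weight x - ρ)) + (B + C + M + 1) * (t - a) := by
  intro x₀ hx₀
  refine le_of_forall_pos_le_add fun ε hε => ?_
  set η := ε / 2 with hη
  have hη0 : 0 < η := by positivity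
  set K := truncation d h ρ with hK
  have : CompactSpace K := isCompact_iff_compactSpace.1 (isCompact_truncation d h ρ)
  set A : Set C(K, ℝ) := {G | ∃ v, IsSubcurve d h M ρ a t v ∧ u t x₀ - η ≤ v t x₀ ∧
    ∀ x : K, G x = v a x - u a x} with hA
  have hAc : Convex ℝ A := by
    rintro G ⟨v, hv, hv1, hv2⟩ H ⟨w, hw, hw1, hw2⟩ p q hp hq hpq
    refine ⟨_, hΩ.isSubcurve_combination hv hw hp hq hpq, ?_, fun x => ?_⟩
    · have h1 : p * (u t x₀ - η) + q * (u t x₀ - η) = u t x₀ - η := by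
        rw [← add_mul, hpq, one_mul]
      linarith [mul_le_mul_of_nonneg_left hv1 hp, mul_le_mul_of_nonneg_left hw1 hq]
    · have : (p • G + q • H) x = p * G x + q * H x := by simp
      rw [this, hv2, hw2]
      linear_combination (-u a x) * hpq
  obtain ⟨δ, hδ, hδb, hδu⟩ : ∃ δ > 0, t + δ < b ∧ ∀ s ∈ Ioc 0 δ, u t x₀ - η ≤ u (t + s) x₀ := by
    have h1 : ∀ᶠ r in 𝓝 t, u t x₀ - η < u r x₀ :=
      ((hu.time_diff x₀ hx₀.1).continuous.tendsto t).eventually_const_lt (by linarith)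
    obtain ⟨r, hr, hr'⟩ := Metric.eventually_nhds_iff.1 h1
    refine ⟨min (r / 2) ((b - t) / 2), ?_, ?_, fun s hs => (hr' ?_).le⟩
    · have := ht.2
      exact lt_min (by positivity) (by linarith)
    · have := min_le_right (r / 2) ((b - t) / 2)
      linarith [ht.2]
    · have := min_le_left (r / 2) ((b - t) / 2)
      rw [Real.dist_eq, add_sub_cancel_left, abs_of_pos hs.1]
      linarith [hs.2]
  have hs : ∀ n : ℕ, δ / (n + 1) ∈ Ioc 0 δ := fun n =>
    ⟨by positivity, div_le_self hδ.le (by linarith [n.cast_nonneg (α := ℝ)])⟩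
  have hcont : ∀ r, ContinuousOn (u r) K := fun r =>
    (hu.space_reg r).continuousOn.mono inter_subset_left
  let F : ℕ → C(K, ℝ) := fun n =>
    ⟨fun x => u (a + δ / (n + 1)) x - u a x,
      (continuousOn_iff_continuous_domRestrict.1 (hcont _)).sub
        (continuousOn_iff_continuous_domRestrict.1 (hcont _))⟩
  obtain ⟨G, ⟨v, hv, hv1, hv2⟩, hG⟩ := exists_mem_convex_forall_le hAc (F := F) (B := 1)
    (fun n => ⟨fun r => u (r + δ / (n + 1)), hu.isSubcurve_shift hM fun r hr =>
        hgood r ⟨by linarith [hr.1, (hs n).1], by linarith [hr.2, (hs n).2]⟩,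
      hδu _ (hs n), fun x => rfl⟩)
    (fun n x => by
      have h1 := hu.range01 (a + δ / (n + 1)) x x.2.1
      have h2 := hu.range01 a x x.2.1
      exact abs_sub_le_iff.2 ⟨by linarith [h1.2, h2.1], by linarith [h1.1, h2.2]⟩)
    (fun x => by
      have h1 : Tendsto (fun n : ℕ => a + δ / (n + 1)) atTop (𝓝 (a + 0)) :=
        tendsto_const_nhds.add (by
          simpa [div_eq_mul_inv] using
            (tendsto_one_div_add_atTop_nhds_zero_nat (𝕜 := ℝ)).const_mul δ)
      rw [add_zero] at h1
      have h2 := ((hu.time_diff x x.2.1).continuous.tendsto a).comp h1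
      have h3 := h2.sub_const (u a x)
      rw [sub_self] at h3
      exact h3) hη0
  have := hv.le_add hΩ ht.1.le (hu.space_reg a) (hu.neumann a)
    (fun x hx => (hu.range01 a x hx).1) hwC hp hB hη0.le hC
    (fun x hx => by
      have h1 := hG ⟨x, hx⟩
      rw [hv2] at h1
      linarith) x₀ hx₀
  linarith

lemma second_difference_le {φ φ₁ φ₂ : ℝ → ℝ} {C r : ℝ} (hr : 0 ≤ r)
    (h1 : ∀ s ∈ Icc (-r) r, HasDerivAt φ (φ₁ s) s)
    (h2 : ∀ s ∈ Icc (-r) r, HasDerivAt φ₁ (φ₂ s) s) (hC : ∀ s ∈ Icc (-r) r, φ₂ s ≤ C) :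
    φ r + φ (-r) - 2 * φ 0 ≤ C * r ^ 2 := by
  have hanti : AntitoneOn (fun s => φ₁ s - C * s) (Icc (-r) r) := by
    have hd : ∀ s ∈ Icc (-r) r, HasDerivAt (fun s => φ₁ s - C * s) (φ₂ s - C) s := fun s hs => by
      simpa using (h2 s hs).fun_sub ((hasDerivAt_id' s).const_mul C)
    refine antitoneOn_of_deriv_nonpos (convex_Icc _ _)
      (fun s hs => (hd s hs).continuousAt.continuousWithinAt)
      (fun s hs => (hd s (interior_subset hs)).differentiableAt.differentiableWithinAt)
      fun s hs => ?_
    rw [(hd s (interior_subset hs)).deriv]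
    linarith [hC s (interior_subset hs)]
  have hd : ∀ s ∈ Icc 0 r, HasDerivAt (fun s => φ s + φ (-s) - C * s ^ 2)
      (φ₁ s - φ₁ (-s) - 2 * C * s) s := fun s hs => by
    have ha := h1 s ⟨by linarith [hs.1], hs.2⟩
    have hb := (h1 (-s) ⟨by linarith [hs.2], by linarith [hs.1]⟩).scomp s (hasDerivAt_neg s)
    have hc := (hasDerivAt_pow 2 s).const_mul C
    refine ((ha.fun_add hb).fun_sub hc).congr_deriv ?_
    simp
    ring
  have hanti2 : AntitoneOn (fun s => φ s + φ (-s) - C * s ^ 2) (Icc 0 r) := by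
    refine antitoneOn_of_deriv_nonpos (convex_Icc _ _)
      (fun s hs => (hd s hs).continuousAt.continuousWithinAt)
      (fun s hs => (hd s (interior_subset hs)).differentiableAt.differentiableWithinAt)
      fun s hs => ?_
    have hs := interior_subset hs
    rw [(hd s hs).deriv]
    have := hanti (a := -s) ⟨by linarith [hs.2], by linarith [hs.1]⟩ (b := s)
      ⟨by linarith [hs.1], hs.2⟩ (by linarith [hs.1])
    simp only at this
    linarith
  have := hanti2 (left_mem_Icc.2 hr) (right_mem_Icc.2 hr) hr
  simp only [neg_zero] at this
  linarith

/-- Quantitative Lipschitz and one-sided second order bounds where the weight is less than `ρ`. -/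
structure IsRegularBelow (d : ℕ) (h : ℝ → ℝ) (C ρ : ℝ) (w : Euc d → ℝ) : Prop where
  lipschitz : ∀ x y, segment ℝ x y ⊆ closure (funnel d h) →
    (∀ z ∈ segment ℝ x y, weight z < ρ) → |w x - w y| ≤ C * ‖x - y‖
  second_difference : ∀ (x : Euc d) (i : Fin (d + 1)) (r : ℝ), 0 ≤ r →
    (fun s : ℝ => x + s • EuclideanSpace.single i (1 : ℝ)) '' Icc (-r) r ⊆ funnel d h →
    (∀ z ∈ (fun s : ℝ => x + s • EuclideanSpace.single i (1 : ℝ)) '' Icc (-r) r, weight z < ρ) →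
    w (x + r • EuclideanSpace.single i (1 : ℝ)) + w (x + (-r) • EuclideanSpace.single i (1 : ℝ))
      - 2 * w x ≤ C * r ^ 2

lemma isOpen_forall_weight_lt {d : ℕ} {S : Set (Euc d)} (hS : IsCompact S) :
    IsOpen {z : ℝ × ℝ | ∀ p ∈ S, weight p < z.2 + 1} := by
  rcases S.eq_empty_or_nonempty with rfl | hne
  · simp
  · obtain ⟨p, hp, hmax⟩ := hS.exists_isMaxOn hne contDiff_weight.continuous.continuousOn
    have : {z : ℝ × ℝ | ∀ p ∈ S, weight p < z.2 + 1} = {z : ℝ × ℝ | weight p < z.2 + 1} := by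
      ext z
      exact ⟨fun hz => hz p hp, fun hz q hq => lt_of_le_of_lt (hmax hq) hz⟩
    rw [this]
    exact isOpen_lt continuous_const (by fun_prop)

lemma IsEntireSolution.isClosed_isRegularBelow {d : ℕ} {h f φ : ℝ → ℝ} {c : ℝ}
    {u : ℝ → Euc d → ℝ} (hu : IsEntireSolution d h f c φ u) (C : ℝ) :
    IsClosed {z : ℝ × ℝ | IsRegularBelow d h C (z.2 + 1) (u z.1)} := by
  have hcont : ∀ x ∈ closure (funnel d h), Continuous fun z : ℝ × ℝ => u z.1 x := fun x hx =>
    (hu.time_diff x hx).continuous.comp continuous_fst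
  have heq : {z : ℝ × ℝ | IsRegularBelow d h C (z.2 + 1) (u z.1)} =
      {z : ℝ × ℝ | ∀ x y : Euc d, segment ℝ x y ⊆ closure (funnel d h) →
        (∀ p ∈ segment ℝ x y, weight p < z.2 + 1) → |u z.1 x - u z.1 y| ≤ C * ‖x - y‖} ∩
      {z : ℝ × ℝ | ∀ (x : Euc d) (i : Fin (d + 1)) (r : ℝ), 0 ≤ r →
        (fun s : ℝ => x + s • EuclideanSpace.single i (1 : ℝ)) '' Icc (-r) r ⊆ funnel d h →
        (∀ p ∈ (fun s : ℝ => x + s • EuclideanSpace.single i (1 : ℝ)) '' Icc (-r) r,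
          weight p < z.2 + 1) →
        u z.1 (x + r • EuclideanSpace.single i (1 : ℝ))
          + u z.1 (x + (-r) • EuclideanSpace.single i (1 : ℝ)) - 2 * u z.1 x ≤ C * r ^ 2} := by
    ext z
    exact ⟨fun hz => ⟨hz.1, hz.2⟩, fun hz => ⟨hz.1, hz.2⟩⟩
  rw [heq]
  refine IsClosed.inter ?_ ?_
  · simp only [ofPred_forall]
    refine isClosed_iInter fun x => isClosed_iInter fun y => isClosed_iInter fun hxy => ?_
    have hS : IsCompact (segment ℝ x y) := by
      rw [segment_eq_image_lineMap]
      exact isCompact_Icc.image (AffineMap.lineMap_continuous)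
    have h3 := isClosed_imp (isOpen_forall_weight_lt hS) (isClosed_le
      ((hcont x (hxy (left_mem_segment ℝ x y))).sub
        (hcont y (hxy (right_mem_segment ℝ x y)))).abs
      (continuous_const (y := C * ‖x - y‖)))
    simpa only [ofPred_forall, Pi.sub_apply, Pi.add_apply] using h3
  · simp only [ofPred_forall]
    refine isClosed_iInter fun x => isClosed_iInter fun i => isClosed_iInter fun r =>
      isClosed_iInter fun hr => isClosed_iInter fun hxr => ?_
    have hm : ∀ s ∈ Icc (-r) r,
        x + s • EuclideanSpace.single i (1 : ℝ) ∈ closure (funnel d h) := fun s hs =>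
      subset_closure (hxr ⟨s, hs, rfl⟩)
    have h0 : x ∈ closure (funnel d h) := by simpa using hm 0 ⟨by linarith, hr⟩
    have hS : IsCompact ((fun s : ℝ => x + s • EuclideanSpace.single i (1 : ℝ)) '' Icc (-r) r) :=
      isCompact_Icc.image (by fun_prop)
    have h3 := isClosed_imp (isOpen_forall_weight_lt hS) (isClosed_le
      (((hcont _ (hm r ⟨by linarith, le_rfl⟩)).add (hcont _ (hm (-r) ⟨le_rfl, by linarith⟩))).sub
        ((hcont x h0).const_mul 2))
      (continuous_const (y := C * r ^ 2)))
    simpa only [ofPred_forall, Pi.sub_apply, Pi.add_apply] using h3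

lemma IsFunnel.exists_isRegularBelow {d : ℕ} {R α L : ℝ} {h : ℝ → ℝ} (hΩ : IsFunnel d R α L h)
    {w : Euc d → ℝ} (hw : ContDiffOn ℝ 2 w (closure (funnel d h))) (ρ : ℝ) :
    ∃ n : ℕ, IsRegularBelow d h n ρ w := by
  have hh := hΩ.smooth.continuous
  have hK := isCompact_truncation d h ρ
  have hsub : truncation d h ρ ⊆ closure (funnel d h) := inter_subset_left
  obtain ⟨C₁, hC₁⟩ := hK.exists_bound_of_continuousOn
    ((hw.continuousOn_fderivWithin hΩ.uniqueDiffOn (by norm_num)).mono hsub)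
  have hp := fun i => hΩ.differentiableOn_partial hw (EuclideanSpace.single i (1 : ℝ))
  have h2 : ∀ i : Fin (d + 1), ∃ C, ∀ x ∈ truncation d h ρ,
      ‖fderivWithin ℝ (fun y => fderivWithin ℝ w (closure (funnel d h)) y
        (EuclideanSpace.single i 1)) (closure (funnel d h)) x‖ ≤ C := fun i =>
    hK.exists_bound_of_continuousOn
      (((hp i).continuousOn_fderivWithin hΩ.uniqueDiffOn (by norm_num)).mono hsub)
  choose C₂ hC₂ using h2
  obtain ⟨n, hn⟩ := exists_nat_ge (|C₁| + ∑ i, |C₂ i|)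
  have hsum : 0 ≤ ∑ i, |C₂ i| := Finset.sum_nonneg fun i _ => abs_nonneg _
  refine ⟨n, fun x y hxy hρ => ?_, fun x i r hr hxr hρ => ?_⟩
  · rw [← Real.norm_eq_abs]
    refine (convex_segment x y).norm_image_sub_le_of_norm_hasFDerivWithin_le
      (fun z hz => ((hw.differentiableOn (by norm_num)) z (hxy hz)).hasFDerivWithinAt.mono hxy)
      (fun z hz => ?_) (right_mem_segment ℝ x y) (left_mem_segment ℝ x y)
    have := hC₁ z ⟨hxy hz, (hρ z hz).le⟩
    linarith [le_abs_self C₁]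
  · have hm : ∀ s ∈ Icc (-r) r, x + s • EuclideanSpace.single i (1 : ℝ) ∈ funnel d h :=
      fun s hs => hxr ⟨s, hs, rfl⟩
    have := second_difference_le (φ := fun s => w (x + s • EuclideanSpace.single i (1 : ℝ))) hr
      (fun s hs => hasDerivAt_along hh (hw.differentiableOn (by norm_num)) (hm s hs))
      (fun s hs => hasDerivAt_along hh ((hp i).differentiableOn (by norm_num)) (hm s hs))
      (C := n) fun s hs => ?_
    · simpa using this
    · refine (le_abs_self _).trans ?_
      rw [← Real.norm_eq_abs]
      refine (ContinuousLinearMap.le_opNorm _ _).trans ?_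
      have h3 := hC₂ i (x + s • EuclideanSpace.single i (1 : ℝ))
        ⟨subset_closure (hm s hs), (hρ _ ⟨s, hs, rfl⟩).le⟩
      have h4 : |C₂ i| ≤ ∑ i, |C₂ i| :=
        Finset.single_le_sum (f := fun i => |C₂ i|) (fun i _ => abs_nonneg _) (Finset.mem_univ i)
      simp only [PiLp.norm_single, norm_one, mul_one]
      linarith [le_abs_self (C₂ i), abs_nonneg C₁]

lemma IsRegularBelow.lapW_le {d : ℕ} {R α L : ℝ} {h : ℝ → ℝ} (hΩ : IsFunnel d R α L h)
    {w : Euc d → ℝ} (hw : ContDiffOn ℝ 2 w (closure (funnel d h))) {C ρ : ℝ}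
    (hreg : IsRegularBelow d h C ρ w) {x : Euc d} (hx : x ∈ funnel d h) (hxρ : weight x < ρ) :
    lapW (closure (funnel d h)) w x ≤ (d + 1) * C := by
  have hh := hΩ.smooth.continuous
  have hsum : ((d : ℝ) + 1) * C = ∑ _i : Fin (d + 1), C := by simp
  rw [hsum, lapW]
  refine Finset.sum_le_sum fun i _ => ?_
  set e : Euc d := EuclideanSpace.single i (1 : ℝ) with he
  have hev : ∀ᶠ s in 𝓝 (0 : ℝ), x + s • e ∈ funnel d h ∧ weight (x + s • e) < ρ := by
    refine (eventually_mem_funnel_line hh hx e).and ?_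
    have hc : Continuous fun s : ℝ => weight (x + s • e) :=
      contDiff_weight.continuous.comp (by fun_prop)
    exact (hc.tendsto 0).eventually_lt_const (by simpa using hxρ)
  obtain ⟨r, hr, hr'⟩ := Metric.eventually_nhds_iff.1 hev
  have hin : ∀ s : ℝ, |s| < r → x + s • e ∈ funnel d h := fun s hs => (hr' (by simpa using hs)).1
  have hball : ∀ᶠ s in 𝓝 (0 : ℝ), |s| < r := by
    filter_upwards [Metric.ball_mem_nhds (0 : ℝ) hr] with s hs
    simpa using hs
  set φ₁ := fun s : ℝ => fderivWithin ℝ w (closure (funnel d h)) (x + s • e) e with hφ₁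
  have hd1 : ∀ s : ℝ, |s| < r → HasDerivAt (fun s : ℝ => w (x + s • e)) (φ₁ s) s := fun s hs =>
    hasDerivAt_along hh (hw.differentiableOn (by norm_num)) (hin s hs)
  have hd2 : HasDerivAt φ₁ (fderivWithin ℝ (fun y => fderivWithin ℝ w (closure (funnel d h)) y e)
      (closure (funnel d h)) x e) 0 := by
    have := hasDerivAt_along hh ((hΩ.differentiableOn_partial hw e).differentiableOn (by norm_num))
      (hin 0 (by simpa using hr))
    simpa only [zero_smul, add_zero] using this
  set A := fderivWithin ℝ (fun y => fderivWithin ℝ w (closure (funnel d h)) y e)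
      (closure (funnel d h)) x e with hA
  suffices A - (-1 : ℝ) * A - C * 2 ≤ 0 by linarith
  refine second_deriv_nonpos_of_isLocalMax
    (φ := fun s => w (x + s • e) + w (x + (-s) • e) - C * s ^ 2)
    (φ₁ := fun s => φ₁ s - φ₁ (-s) - C * (2 * s)) ?_ ?_ ?_
  · filter_upwards [hball] with s hs
    have hb := (hd1 (-s) (by simpa using hs)).scomp s (hasDerivAt_neg s)
    refine (((hd1 s hs).fun_add hb).fun_sub ((hasDerivAt_pow 2 s).const_mul C)).congr_deriv ?_
    simp
    ring
  · have hb : HasDerivAt (fun s => φ₁ (-s)) ((-1 : ℝ) * A) 0 := by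
      have h0 : HasDerivAt φ₁ A (-0) := by simpa using hd2
      exact h0.scomp (0 : ℝ) (hasDerivAt_neg (0 : ℝ))
    have hc : HasDerivAt (fun s : ℝ => C * (2 * s)) (C * 2) 0 := by
      simpa using ((hasDerivAt_id' (0 : ℝ)).const_mul 2).const_mul C
    exact (hd2.fun_sub hb).fun_sub hc
  · filter_upwards [hball] with s hs
    have hsd := hreg.second_difference x i |s| (abs_nonneg s)
      (by rintro _ ⟨σ, hσ, rfl⟩; exact hin σ ((abs_le.2 hσ).trans_lt hs))
      (by
        rintro _ ⟨σ, hσ, rfl⟩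
        exact (hr' (by simpa using (abs_le.2 hσ).trans_lt hs)).2)
    rw [sq_abs] at hsd
    simp only [neg_zero, zero_smul, add_zero]
    rcases abs_cases s with ⟨h1, _⟩ | ⟨h1, _⟩
    · rw [h1] at hsd
      linarith
    · rw [h1, neg_neg] at hsd
      linarith

lemma primeNorm_add_smul {d : ℕ} (x : Euc d) (a : ℝ) :
    primeNorm (x + a • EuclideanSpace.single 0 (1 : ℝ)) = primeNorm x := by
  simpa using primeNorm_sub_smul x zero_le_one a

lemma IsRegularBelow.abs_sub_le {d : ℕ} {R α L : ℝ} {h : ℝ → ℝ} (hΩ : IsFunnel d R α L h)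
    {w : Euc d → ℝ} {C ρ r : ℝ} (hC : 0 ≤ C) (hreg : IsRegularBelow d h C ρ w) {x y : Euc d}
    (hx : x ∈ closure (funnel d h)) (hy : y ∈ closure (funnel d h))
    (hball : ∀ z ∈ Metric.ball x r, weight z < ρ) (hxy : ‖x - y‖ < r / 2) :
    |w x - w y| ≤ C * (4 * ‖x - y‖) := by
  rw [hΩ.closure_eq] at hx hy
  have hx : primeNorm x ≤ h (x 0) := hx
  have hy : primeNorm y ≤ h (y 0) := hy
  set e : Euc d := EuclideanSpace.single 0 (1 : ℝ) with he
  have hen : ∀ a : ℝ, ‖a • e‖ = |a| := fun a => by simp [he, norm_smul]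
  set m := max (x 0) (y 0) with hm
  set p := x + (m - x 0) • e with hp
  set q := y + (m - y 0) • e with hq
  have hp0 : p 0 = m := by simp [hp, he]
  have hq0 : q 0 = m := by simp [hq, he]
  have hpn : primeNorm p = primeNorm x := primeNorm_add_smul x _
  have hqn : primeNorm q = primeNorm y := primeNorm_add_smul y _
  have hcoord : |x 0 - y 0| ≤ ‖x - y‖ := by simpa using PiLp.norm_apply_le (x - y) 0
  have hpx : ‖x - p‖ ≤ ‖x - y‖ := by
    have : x - p = (-(m - x 0)) • e := by rw [hp]; module
    rw [this, hen, abs_neg]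
    refine le_trans ?_ hcoord
    rcases le_total (x 0) (y 0) with h1 | h1
    · rw [hm, max_eq_right h1, abs_sub_comm]
    · rw [hm, max_eq_left h1]; simp
  have hqy : ‖q - y‖ ≤ ‖x - y‖ := by
    have : q - y = (m - y 0) • e := by rw [hq]; module
    rw [this, hen]
    refine le_trans ?_ hcoord
    rcases le_total (x 0) (y 0) with h1 | h1
    · rw [hm, max_eq_right h1]; simp
    · rw [hm, max_eq_left h1]
  have hpq : ‖p - q‖ ≤ 2 * ‖x - y‖ := by
    have : p - q = (x - y) + (y 0 - x 0) • e := by rw [hp, hq]; module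
    rw [this]
    refine (norm_add_le _ _).trans ?_
    rw [hen, abs_sub_comm]
    linarith
  have hr : 0 < r := by linarith [norm_nonneg (x - y)]
  have hxB : x ∈ Metric.ball x r := Metric.mem_ball_self hr
  have hyB : y ∈ Metric.ball x r := by
    rw [Metric.mem_ball', dist_eq_norm]; linarith
  have hpB : p ∈ Metric.ball x r := by
    rw [Metric.mem_ball', dist_eq_norm]; linarith
  have hqB : q ∈ Metric.ball x r := by
    rw [Metric.mem_ball', dist_eq_norm]
    have : ‖x - q‖ ≤ ‖x - y‖ + ‖q - y‖ := by
      have h1 := norm_sub_le (x - y) (q - y)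
      rwa [sub_sub_sub_cancel_right] at h1
    linarith
  have key : ∀ (a s : ℝ) {z z' : Euc d}, s ≤ h a → a ≤ z 0 → a ≤ z' 0 → primeNorm z ≤ s →
      primeNorm z' ≤ s → z ∈ Metric.ball x r → z' ∈ Metric.ball x r →
      |w z - w z'| ≤ C * ‖z - z'‖ := by
    intro a s z z' hs hz hz' hzs hzs' hzB hzB'
    refine hreg.lipschitz z z' (fun v hv => ?_)
      fun v hv => hball v ((convex_ball x r).segment_subset hzB hzB' hv)
    have hv' := (convex_cylinder a s).segment_subset (show _ ∧ _ from ⟨hz, hzs⟩)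
      (show _ ∧ _ from ⟨hz', hzs'⟩) hv
    exact hΩ.mem_closure_of_le hv'.1 (hv'.2.trans hs)
  have hxm : x 0 ≤ m := le_max_left _ _
  have hym : y 0 ≤ m := le_max_right _ _
  have h1 := key (x 0) (h (x 0)) le_rfl le_rfl (hp0 ▸ hxm) hx (hpn.trans_le hx) hxB hpB
  have h2 := key m (h m) le_rfl hp0.ge hq0.ge (hpn.trans_le (hx.trans (hΩ.monotone hxm)))
    (hqn.trans_le (hy.trans (hΩ.monotone hym))) hpB hqB
  have h3 := key (y 0) (h (y 0)) le_rfl (hq0 ▸ hym) le_rfl (hqn.trans_le hy) hy hqB hyB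
  have h4 : |w x - w y| ≤ |w x - w p| + |w p - w q| + |w q - w y| := by
    have := _root_.abs_sub_le (w x) (w p) (w y)
    have := _root_.abs_sub_le (w p) (w q) (w y)
    linarith
  nlinarith [mul_le_mul_of_nonneg_left hpx hC, mul_le_mul_of_nonneg_left hpq hC,
    mul_le_mul_of_nonneg_left hqy hC]

/-- On a set of times with uniform regularity, the solution is continuous in time uniformly on
truncations. -/
lemma IsEntireSolution.eventually_abs_sub_le {d : ℕ} {R α L : ℝ} {h f φ : ℝ → ℝ} {c : ℝ}
    {u : ℝ → Euc d → ℝ} (hu : IsEntireSolution d h f c φ u) (hΩ : IsFunnel d R α L h)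
    {E : Set ℝ} {C ρ τ : ℝ} (hC : 0 ≤ C) (hE : ∀ s ∈ E, IsRegularBelow d h C (ρ + 1) (u s))
    (hτ : τ ∈ E) {ε : ℝ} (hε : 0 < ε) :
    ∀ᶠ s in 𝓝[E] τ, ∀ x ∈ truncation d h ρ, |u s x - u τ x| ≤ ε := by
  refine (isCompact_truncation d h ρ).induction_on
    (p := fun S => ∀ᶠ s in 𝓝[E] τ, ∀ x ∈ S, |u s x - u τ x| ≤ ε) ?_ ?_ ?_ ?_
  · simp
  · intro S T hST hT
    exact hT.mono fun s hs x hx => hs x (hST hx)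
  · intro S T hS hT
    filter_upwards [hS, hT] with s h1 h2 x hx
    exact hx.elim (h1 x) (h2 x)
  · intro x hx
    obtain ⟨r, hr, hball⟩ := Metric.eventually_nhds_iff.1
      ((contDiff_weight.continuous.tendsto x).eventually_lt_const
        (lt_of_le_of_lt (show weight x ≤ ρ from hx.2) (lt_add_one ρ)))
    set δ := min (r / 2) (ε / (12 * (C + 1))) with hδ
    have hδ0 : 0 < δ := lt_min (by positivity) (by positivity)
    have hδε : C * (4 * δ) ≤ ε / 3 := by
      have h1 : δ ≤ ε / (12 * (C + 1)) := min_le_right _ _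
      rw [le_div_iff₀ (by positivity)] at h1
      nlinarith
    refine ⟨truncation d h ρ ∩ Metric.ball x δ,
      inter_mem self_mem_nhdsWithin (mem_nhdsWithin_of_mem_nhds (Metric.ball_mem_nhds x hδ0)), ?_⟩
    have hclose : ∀ s ∈ E, ∀ y ∈ truncation d h ρ ∩ Metric.ball x δ, |u s x - u s y| ≤ ε / 3 := by
      intro s hs y hy
      have hxy : ‖x - y‖ < δ := by
        rw [← dist_eq_norm]; exact Metric.mem_ball'.1 hy.2
      have := (hE s hs).abs_sub_le hΩ hC hx.1 hy.1.1 (fun z hz => hball hz)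
        (hxy.trans_le (min_le_left _ _))
      nlinarith [mul_le_mul_of_nonneg_left hxy.le hC]
    have hpt : ∀ᶠ s in 𝓝[E] τ, |u s x - u τ x| < ε / 3 := by
      have h1 : Tendsto (fun s => |u s x - u τ x|) (𝓝 τ) (𝓝 |u τ x - u τ x|) :=
        (((hu.time_diff x hx.1).continuous.tendsto τ).sub_const _).abs
      rw [sub_self, abs_zero] at h1
      exact (h1.mono_left nhdsWithin_le_nhds).eventually_lt_const (by positivity)
    filter_upwards [hpt, self_mem_nhdsWithin] with s hs hsE y hy
    have h1 := abs_le.1 (hclose s hsE y hy)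
    have h2 := abs_le.1 (hclose τ hτ y hy)
    have h3 := abs_lt.1 hs
    exact abs_le.2 ⟨by linarith [h1.1, h1.2, h2.1, h2.2], by linarith [h1.1, h1.2, h2.1, h2.2]⟩

lemma exists_barrier_bound {d : ℕ} (h : ℝ → ℝ) (ρ p : ℝ) : ∃ B, 0 ≤ B ∧
    ∀ x ∈ truncation d h ρ, ∑ i, (p * (p * Real.exp (p * (weight x - ρ)))
      * (2 * x i - if i = 0 then 1 else 0) ^ 2 + p * Real.exp (p * (weight x - ρ)) * 2) ≤ B := by
  have hw := (contDiff_weight (d := d)).continuous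
  obtain ⟨B, hB⟩ := (isCompact_truncation d h ρ).exists_bound_of_continuousOn
    (f := fun x : Euc d => ∑ i, (p * (p * Real.exp (p * (weight x - ρ)))
      * (2 * x i - if i = 0 then 1 else 0) ^ 2 + p * Real.exp (p * (weight x - ρ)) * 2))
    (Continuous.continuousOn (by fun_prop))
  refine ⟨|B|, abs_nonneg B, fun x hx => ?_⟩
  exact (le_abs_self _).trans ((hB x hx).trans (le_abs_self B))

/-- If the solution is right upper semicontinuous at level `ρ'` outside a relatively closed set of
times with uniform regularity, then it is so at all times at every smaller level. -/
lemma IsEntireSolution.rightUSC_of_regular {d : ℕ} {R α L : ℝ} {h f φ : ℝ → ℝ} {c : ℝ}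
    {u : ℝ → Euc d → ℝ} (hu : IsEntireSolution d h f c φ u) (hΩ : IsFunnel d R α L h)
    {M : ℝ} (hM0 : 0 ≤ M) (hM : ∀ y ∈ Icc (0 : ℝ) 1, f y ≤ M) {Z : Set ℝ} (hZ : IsClosed Z)
    {a b C ρ ρ' : ℝ} (hC : 0 ≤ C) (hρ : ρ < ρ')
    (hreg : ∀ t ∈ Ioo a b ∩ Z, IsRegularBelow d h C (ρ' + 1) (u t))
    (hgood : ∀ t ∈ Ioo a b, t ∉ Z → RightUSC d h u t ρ') {τ : ℝ} (hτ : τ ∈ Ioo a b) :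
    RightUSC d h u τ ρ := by
  by_cases hτZ : τ ∉ Z
  · exact (hgood τ hτ hτZ).mono hρ.le
  rw [not_not] at hτZ
  intro ε hε
  obtain ⟨p, hp, hpε⟩ : ∃ p : ℝ, 0 < p ∧ Real.exp (p * (ρ - ρ')) ≤ ε / 3 := by
    have h1 : Tendsto (fun p : ℝ => Real.exp (p * (ρ - ρ'))) atTop (𝓝 0) :=
      Real.tendsto_exp_atBot.comp (tendsto_id.atTop_mul_const_of_neg (sub_neg.2 hρ))
    have h2 : ∀ᶠ p : ℝ in atTop, Real.exp (p * (ρ - ρ')) < ε / 3 :=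
      h1.eventually_lt_const (by positivity)
    obtain ⟨p, h3, h4⟩ := ((eventually_gt_atTop (0 : ℝ)).and h2).exists
    exact ⟨p, h3, h4.le⟩
  obtain ⟨B, hB0, hB⟩ := exists_barrier_bound (d := d) h ρ' p
  set κ := B + (d + 1) * C + M + 1 with hκ
  have hκ0 : 0 < κ := by positivity
  have hequi := hu.eventually_abs_sub_le hΩ hC hreg ⟨hτ, hτZ⟩ (ε := ε / 3) (by positivity)
  obtain ⟨δ, hδ, hδ'⟩ := Metric.mem_nhdsWithin_iff.1 hequi
  have hT : τ < min (min b (τ + δ)) (τ + ε / (3 * κ)) :=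
    lt_min (lt_min hτ.2 (by linarith)) (by linarith [show 0 < ε / (3 * κ) by positivity])
  filter_upwards [Ioo_mem_nhdsGT hT] with t ht x hx
  have htb : t < b := ht.2.trans_le ((min_le_left _ _).trans (min_le_left _ _))
  have htδ : t < τ + δ := ht.2.trans_le ((min_le_left _ _).trans (min_le_right _ _))
  have htκ : κ * (t - τ) ≤ ε / 3 := by
    have h1 : t - τ ≤ ε / (3 * κ) := by linarith [ht.2.trans_le (min_le_right _ _)]
    rw [le_div_iff₀ (by positivity)] at h1
    linarith
  have hx' : x ∈ truncation d h ρ' := ⟨hx.1, le_trans hx.2 hρ.le⟩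
  have hnear : ∀ s ∈ Icc τ t, s ∈ Z → u s x ≤ u τ x + ε / 3 := by
    intro s hs hsZ
    have h1 : s ∈ Metric.ball τ δ := by
      rw [Metric.mem_ball, Real.dist_eq, abs_of_nonneg (by linarith [hs.1])]
      linarith [hs.2]
    have h2 : ∀ x ∈ truncation d h ρ', |u s x - u τ x| ≤ ε / 3 :=
      hδ' ⟨h1, ⟨hτ.1.trans_le hs.1, hs.2.trans_lt htb⟩, hsZ⟩
    linarith [(abs_le.1 (h2 x hx')).2]
  have hcomp : IsCompact (Icc τ t ∩ Z) := isCompact_Icc.inter_right hZ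
  set σ := sSup (Icc τ t ∩ Z) with hσ
  have hσm : σ ∈ Icc τ t ∩ Z := hcomp.sSup_mem ⟨τ, left_mem_Icc.2 ht.1.le, hτZ⟩
  have hσab : σ ∈ Ioo a b := ⟨hτ.1.trans_le hσm.1.1, hσm.1.2.trans_lt htb⟩
  have hσu := hnear σ hσm.1 hσm.2
  have hafter : ∀ s ∈ Ioc σ t, s ∉ Z := by
    intro s hs hsZ
    exact absurd (le_csSup hcomp.bddAbove ⟨⟨hσm.1.1.trans hs.1.le, hs.2⟩, hsZ⟩) (not_le.2 hs.1)
  rcases hσm.1.2.eq_or_lt with h1 | h1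
  · rw [h1] at hσu
    linarith
  · have htZ : t ∉ Z := hafter t ⟨h1, le_rfl⟩
    obtain ⟨r, hr, hrZ⟩ := Metric.isOpen_iff.1 hZ.isOpen_compl t htZ
    have hgap : ∀ s ∈ Ioo σ (min b (t + r)), RightUSC d h u s ρ' := by
      intro s hs
      refine hgood s ⟨hσab.1.trans hs.1, hs.2.trans_le (min_le_left _ _)⟩ ?_
      rcases le_or_gt s t with h2 | h2
      · exact hafter s ⟨hs.1, h2⟩
      · refine hrZ ?_
        rw [Metric.mem_ball, Real.dist_eq, abs_of_pos (by linarith)]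
        linarith [hs.2.trans_le (min_le_right b (t + r))]
    have h3 := hu.le_add_of_rightUSC hΩ hM hgap
      (fun y hy hyρ => (hreg σ ⟨hσab, hσm.2⟩).lapW_le hΩ (hu.space_reg σ) hy (by linarith))
      hp hB hκ0.le (t := t) ⟨h1, lt_min htb (by linarith)⟩ x hx'
    have h4 : Real.exp (p * (weight x - ρ')) ≤ ε / 3 := by
      refine le_trans (Real.exp_le_exp.2 ?_) hpε
      have : weight x ≤ ρ := hx.2
      nlinarith
    have h5 : κ * (t - σ) ≤ κ * (t - τ) := by nlinarith [hσm.1.1]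
    linarith

/-- A solution is upper semicontinuous from the right in time, locally uniformly in space. -/
theorem IsEntireSolution.rightUSC {d : ℕ} {R α L : ℝ} {h f φ : ℝ → ℝ} {c : ℝ}
    {u : ℝ → Euc d → ℝ} (hu : IsEntireSolution d h f c φ u) (hΩ : IsFunnel d R α L h)
    (hf : Continuous f) (t ρ : ℝ) : RightUSC d h u t ρ := by
  obtain ⟨M, hM0, hM⟩ : ∃ M, 0 ≤ M ∧ ∀ y ∈ Icc (0 : ℝ) 1, f y ≤ M := by
    obtain ⟨M, hM⟩ := isCompact_Icc.exists_bound_of_continuousOn (s := Icc (0 : ℝ) 1)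
      hf.continuousOn
    exact ⟨M, (norm_nonneg _).trans (hM 0 (by simp)), fun y hy => (le_abs_self _).trans (hM y hy)⟩
  set Bad : Set (ℝ × ℝ) := {z | ¬ RightUSC d h u z.1 z.2} with hBad
  by_contra hcon
  have hne : (closure Bad).Nonempty := ⟨(t, ρ), subset_closure hcon⟩
  have : Nonempty (closure Bad) := hne.to_subtype
  have : CompleteSpace (closure Bad) := isClosed_closure.completeSpace_coe
  obtain ⟨n, ⟨z₀, hz₀⟩, hint⟩ := nonempty_interior_of_iUnion_of_closed
    (f := fun n : ℕ => ((↑) : closure Bad → ℝ × ℝ) ⁻¹'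
      {z | IsRegularBelow d h n (z.2 + 1) (u z.1)})
    (fun n => (hu.isClosed_isRegularBelow n).preimage continuous_subtype_val)
    (eq_univ_of_forall fun z => mem_iUnion.2
      (hΩ.exists_isRegularBelow (hu.space_reg z.1.1) (z.1.2 + 1)))
  obtain ⟨ε, hε, hball⟩ := Metric.mem_nhds_iff.1 (mem_interior_iff_mem_nhds.1 hint)
  have hreg : ∀ z ∈ closure Bad, dist z z₀ < ε → IsRegularBelow d h n (z.2 + 1) (u z.1) :=
    fun z hz hd => hball (show (⟨z, hz⟩ : closure Bad) ∈ Metric.ball ⟨z₀, hz₀⟩ ε from hd)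
  set ρ' := z₀.2 + ε / 2 with hρ'
  have hgood : ∀ τ ∈ Ioo (z₀.1 - ε) (z₀.1 + ε), RightUSC d h u τ (z₀.2 + ε / 4) := by
    intro τ hτ
    refine hu.rightUSC_of_regular hΩ hM0 hM (Z := {s | (s, ρ') ∈ closure Bad})
      (isClosed_closure.preimage (by fun_prop)) (C := n) (ρ' := ρ') n.cast_nonneg
      (by linarith) ?_ ?_ hτ
    · intro s hs
      refine hreg (s, ρ') hs.2 ?_
      rw [Prod.dist_eq]
      refine max_lt ?_ ?_
      · rw [Real.dist_eq]
        exact abs_lt.2 ⟨by linarith [hs.1.1], by linarith [hs.1.2]⟩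
      · simp only [hρ', Real.dist_eq, add_sub_cancel_left]
        rw [abs_of_pos (by positivity)]
        linarith
    · intro s _ hs
      by_contra hs'
      exact hs (subset_closure hs')
  obtain ⟨z, hz, hzd⟩ := Metric.mem_closure_iff.1 hz₀ (ε / 4) (by positivity)
  rw [Prod.dist_eq, max_lt_iff, Real.dist_eq, Real.dist_eq, abs_lt, abs_lt] at hzd
  refine hz ((hgood z.1 ⟨?_, ?_⟩).mono ?_)
  all_goals linarith [hzd.1.1, hzd.1.2, hzd.2.1, hzd.2.2]

lemma weight_pos {d : ℕ} (x : Euc d) : 0 < weight x := by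
  have h0 : x 0 ≤ ‖x‖ := (le_abs_self _).trans (by simpa using PiLp.norm_apply_le x 0)
  unfold weight
  nlinarith [sq_nonneg (‖x‖ - 1 / 2)]

/-- Comparison between the solution and a stationary solution, when the nonlinearity satisfies a
one-sided Lipschitz bound wherever the solution exceeds the stationary one. -/
lemma IsEntireSolution.sub_le_mul_exp {d : ℕ} {R α L : ℝ} {h f φ : ℝ → ℝ} {c : ℝ}
    {u : ℝ → Euc d → ℝ} (hu : IsEntireSolution d h f c φ u) (hΩ : IsFunnel d R α L h)
    (hf : Continuous f) {U : Euc d → ℝ} (hU2 : ContDiffOn ℝ 2 U (closure (funnel d h)))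
    (hUrange : ∀ x ∈ closure (funnel d h), U x ∈ Ioc (0 : ℝ) 1)
    (hUpde : ∀ x ∈ closure (funnel d h), lapW (closure (funnel d h)) U x + f (U x) = 0)
    (hUneu : ∀ x ∈ frontier (funnel d h), neumannLHS h U x = 0) {k m a b : ℝ} (hm : 0 ≤ m)
    (hab : a ≤ b)
    (hk : ∀ t ∈ Icc a b, ∀ x ∈ closure (funnel d h), U x < u t x →
      f (u t x) - f (U x) ≤ -k * (u t x - U x))
    (hinit : ∀ x ∈ closure (funnel d h), u a x - U x ≤ m) :
    ∀ x ∈ closure (funnel d h), u b x - U x ≤ m * Real.exp (-k * (b - a)) := by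
  intro x₀ hx₀
  set N : ℝ := 2 * (d + 1) + 1 with hN
  have hN0 : 0 < N := by positivity
  have hdiff : ∀ t, ∀ x ∈ closure (funnel d h), |u t x - U x| ≤ 1 := fun t x hx =>
    abs_sub_le_iff.2 ⟨by linarith [(hu.range01 t x hx).2, (hUrange x hx).1],
      by linarith [(hu.range01 t x hx).1, (hUrange x hx).2]⟩
  have hE : ∀ t, HasDerivAt (fun t => Real.exp (k * (t - a))) (k * Real.exp (k * (t - a))) t := by
    intro t
    have := (((hasDerivAt_id t).sub_const a).const_mul k).exp
    refine this.congr_deriv ?_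
    simp; ring
  have hEle : ∀ t ∈ Icc a b, Real.exp (k * (t - a)) ≤ Real.exp (|k| * (b - a)) := by
    intro t ht
    refine Real.exp_le_exp.2 ?_
    have h1 : k * (t - a) ≤ |k| * (t - a) :=
      mul_le_mul_of_nonneg_right (le_abs_self k) (by linarith [ht.1])
    have h2 : |k| * (t - a) ≤ |k| * (b - a) :=
      mul_le_mul_of_nonneg_left (by linarith [ht.2]) (abs_nonneg k)
    linarith
  have main : ∀ ε > 0, Real.exp (k * (b - a)) * (u b x₀ - U x₀)
      ≤ m + ε * (weight x₀ + N * (b - a)) := by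
    intro ε hε
    set ρ := max (weight x₀) (Real.exp (|k| * (b - a)) / ε) with hρ
    have hρε : Real.exp (|k| * (b - a)) ≤ ε * ρ := by
      have := le_max_right (weight x₀) (Real.exp (|k| * (b - a)) / ε)
      rw [div_le_iff₀ hε] at this
      linarith
    have hmp := forall_le_of_deriv_neg_at_max (m := m)
      (q := fun t x => Real.exp (k * (t - a)) * (u t x - U x) - ε * (weight x + N * (t - a)))
      (isCompact_truncation d h ρ) hab ?_ ?_ ?_ ?_ x₀
      ⟨hx₀, show weight x₀ ≤ ρ from le_max_left _ _⟩
    · linarith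
    · intro t _
      have h1 : ContinuousOn (u t) (truncation d h ρ) :=
        (hu.space_reg t).continuousOn.mono inter_subset_left
      have h2 : ContinuousOn U (truncation d h ρ) := hU2.continuousOn.mono inter_subset_left
      have h3 := (contDiff_weight (d := d)).continuous
      exact (continuousOn_const.mul (h1.sub h2)).sub (Continuous.continuousOn (by fun_prop))
    · intro t ht ε' hε'
      set Et := Real.exp (k * (t - a)) with hEt
      have hEt0 : 0 < Et := Real.exp_pos _
      have hclose : ∀ᶠ s in 𝓝[>] t, |Real.exp (k * (s - a)) - Et| < min 1 (ε' / 2) := by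
        have h1 : Tendsto (fun s => |Real.exp (k * (s - a)) - Et|) (𝓝 t) (𝓝 |Et - Et|) :=
          ((hE t).continuousAt.tendsto.sub_const Et).abs
        rw [sub_self, abs_zero] at h1
        exact (h1.mono_left nhdsWithin_le_nhds).eventually_lt_const
          (lt_min one_pos (by positivity))
      filter_upwards [hu.rightUSC hΩ hf t ρ (ε' / (2 * (Et + 1))) (by positivity), hclose,
        self_mem_nhdsWithin] with s hs hs' hts x hx
      have hts : t < s := hts
      have h1 := hs x hx
      have h2 : |Real.exp (k * (s - a)) - Et| < 1 := hs'.trans_le (min_le_left _ _)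
      have h3 : |Real.exp (k * (s - a)) - Et| ≤ ε' / 2 := (hs'.trans_le (min_le_right _ _)).le
      set Es := Real.exp (k * (s - a)) with hEs
      have hEs0 : 0 < Es := Real.exp_pos _
      have h4 : Es * (u s x - u t x) ≤ ε' / 2 := by
        have h5 : Es * (u s x - u t x) ≤ Es * (ε' / (2 * (Et + 1))) :=
          mul_le_mul_of_nonneg_left (by linarith) hEs0.le
        have h6 : Es * (ε' / (2 * (Et + 1))) ≤ (Et + 1) * (ε' / (2 * (Et + 1))) :=
          mul_le_mul_of_nonneg_right (by linarith [(abs_lt.1 h2).2]) (by positivity)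
        have h7 : (Et + 1) * (ε' / (2 * (Et + 1))) = ε' / 2 := by field_simp
        linarith
      have h5 : (Es - Et) * (u t x - U x) ≤ ε' / 2 := by
        refine (le_abs_self _).trans ?_
        rw [abs_mul]
        have := hdiff t x hx.1
        nlinarith [abs_nonneg (Es - Et), abs_nonneg (u t x - U x)]
      nlinarith [mul_nonneg hε.le (mul_nonneg hN0.le (sub_nonneg.2 hts.le))]
    · intro t ht x hx hmax hq
      have ht' : t ∈ Icc a b := ⟨ht.1.le, ht.2⟩
      set Et := Real.exp (k * (t - a)) with hEt
      have hEt0 : 0 < Et := Real.exp_pos _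
      have hNt : 0 ≤ ε * (N * (t - a)) := by
        have := sub_nonneg.2 ht.1.le
        positivity
      have hpos : 0 < ε * weight x := mul_pos hε (weight_pos x)
      have hgt : U x < u t x := by
        by_contra! hle
        have : Et * (u t x - U x) ≤ 0 :=
          mul_nonpos_of_nonneg_of_nonpos hEt0.le (sub_nonpos.2 hle)
        simp only [mul_add] at hq
        linarith
      have hxρ : weight x < ρ := by
        refine lt_of_le_of_ne hx.2 fun he => ?_
        have he : weight x = ρ := he
        have h1 : Et * (u t x - U x) ≤ Et * 1 :=
          mul_le_mul_of_nonneg_left ((le_abs_self _).trans (hdiff t x hx.1)) hEt0.le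
        have h2 : Et ≤ Real.exp (|k| * (b - a)) := hEle t ht'
        simp only [mul_add, he] at hq
        linarith
      have hloc := isLocalMaxOn_of_isMaxOn_truncation hmax hxρ
      have hloc' : IsLocalMaxOn (fun y => (Et * u t y + (-Et) * U y) - ε * weight y)
          (closure (funnel d h)) x := by
        filter_upwards [hloc] with y hy
        linarith
      obtain ⟨-, hlap⟩ := hΩ.lapW_le_of_isLocalMaxOn
        (ψ := fun y => ε * y) (ψ₁ := fun _ => ε) (ψ₂ := fun _ => 0)
        ((contDiffOn_const.mul (hu.space_reg t)).add (contDiffOn_const.mul hU2))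
        (hΩ.neumannLHS_add_mul (hu.space_reg t) hU2 Et (-Et) (hu.neumann t) hUneu)
        (fun y => by simpa using (hasDerivAt_id' y).const_mul ε)
        (fun y => hasDerivAt_const y ε) (fun _ => hε) hx.1 hloc'
      rw [hΩ.lapW_add_mul (hu.space_reg t) hU2 Et (-Et) hx.1] at hlap
      have hsum : ∑ i : Fin (d + 1), (0 * (2 * x i - if i = 0 then 1 else 0) ^ 2 + ε * 2)
          = ε * (2 * (d + 1)) := by
        simp; ring
      rw [hsum] at hlap
      have hut : HasDerivAt (fun s => u s x)
          (lapW (closure (funnel d h)) (u t) x + f (u t x)) t := by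
        rw [← hu.pde t x hx.1]
        exact (hu.time_diff x hx.1 t).hasDerivAt
      have hfk : Et * (f (u t x) - f (U x)) ≤ Et * (-k * (u t x - U x)) :=
        mul_le_mul_of_nonneg_left (hk t ht' x hx.1 hgt) hEt0.le
      have hUx : Et * lapW (closure (funnel d h)) U x + Et * f (U x) = 0 := by
        rw [← mul_add, hUpde x hx.1, mul_zero]
      refine ⟨_, ?_, ((hE t).fun_mul (hut.sub_const (U x))).fun_sub
        ((((hasDerivAt_id' t).sub_const a).const_mul N).const_add (weight x) |>.const_mul ε)⟩
      rw [hN]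
      simp only [← hEt]
      nlinarith
    · intro x hx
      have h1 := hinit x hx.1
      have h2 := mul_pos hε (weight_pos x)
      simp only [sub_self, mul_zero, Real.exp_zero, add_zero, one_mul]
      linarith
  have hlim : Real.exp (k * (b - a)) * (u b x₀ - U x₀) ≤ m := by
    have h1 : Tendsto (fun ε : ℝ => m + ε * (weight x₀ + N * (b - a))) (𝓝[>] 0) (𝓝 m) := by
      have : Continuous fun ε : ℝ => m + ε * (weight x₀ + N * (b - a)) := by fun_prop
      have h2 := (this.tendsto 0).mono_left (nhdsWithin_le_nhds (s := Ioi 0))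
      simpa using h2
    refine ge_of_tendsto h1 ?_
    filter_upwards [self_mem_nhdsWithin] with ε hε using main ε hε
  have h1 : Real.exp (-k * (b - a)) * Real.exp (k * (b - a)) = 1 := by
    rw [← Real.exp_add]; simp
  calc u b x₀ - U x₀ = Real.exp (-k * (b - a)) * (Real.exp (k * (b - a)) * (u b x₀ - U x₀)) := by
        rw [← mul_assoc, h1, one_mul]
    _ ≤ Real.exp (-k * (b - a)) * m := mul_le_mul_of_nonneg_left hlim (Real.exp_pos _).le
    _ = m * Real.exp (-k * (b - a)) := mul_comm _ _

lemma exists_sub_le_of_deriv_neg {f : ℝ → ℝ} (hf : ContDiff ℝ 1 f) {z : ℝ} (hz : deriv f z < 0) :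
    ∃ δ > 0, ∀ x ∈ Icc (z - δ) (z + δ), ∀ y ∈ Icc (z - δ) (z + δ), y ≤ x →
      f x - f y ≤ deriv f z / 2 * (x - y) := by
  have hc : Continuous (deriv f) := hf.continuous_deriv (by norm_num)
  obtain ⟨r, hr, hr'⟩ := Metric.eventually_nhds_iff.1
    ((hc.tendsto z).eventually_lt_const (show deriv f z < deriv f z / 2 by linarith))
  refine ⟨r / 2, by positivity, fun x hx y hy hyx => ?_⟩
  refine (convex_Icc (z - r / 2) (z + r / 2)).image_sub_le_mul_sub_of_deriv_le
    hf.continuous.continuousOn (hf.differentiable (by norm_num)).differentiableOn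
    (fun s hs => (hr' ?_).le) y hy x hx hyx
  have hs := interior_subset hs
  rw [Real.dist_eq, abs_lt]
  constructor <;> linarith [hs.1, hs.2]

/-- Corollary 2.1: if `U` is a stationary solution with `0 < U ≤ 1` and
`U(x) → 1` as `x₁ → -∞`, then the entire solution emanating from the planar front satisfies
`u(t,x) ≤ U(x)` everywhere. -/
theorem statement8 (d : ℕ) (f φ h : ℝ → ℝ) (θ c R α L : ℝ)
    (hf : Bistable f θ) (hφ : PlanarFront f θ c φ) (hΩ : IsFunnel d R α L h)
    (u : ℝ → Euc d → ℝ) (hu : IsEntireSolution d h f c φ u)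
    (U : Euc d → ℝ)
    (hU2 : ContDiffOn ℝ 2 U (closure (funnel d h)))
    (hUrange : ∀ x ∈ closure (funnel d h), U x ∈ Ioc (0 : ℝ) 1)
    (hUpde : ∀ x ∈ closure (funnel d h), lapW (closure (funnel d h)) U x + f (U x) = 0)
    (hUneu : ∀ x ∈ frontier (funnel d h), neumannLHS h U x = 0)
    (hUlim : ∀ ε > (0 : ℝ), ∃ A : ℝ, ∀ x ∈ closure (funnel d h), x 0 ≤ A → 1 - ε ≤ U x) :
    ∀ t : ℝ, ∀ x ∈ closure (funnel d h), u t x ≤ U x := by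
  have hfc := hf.smooth.continuous
  obtain ⟨δ₀, hδ₀, h0⟩ := exists_sub_le_of_deriv_neg hf.smooth hf.df0
  obtain ⟨δ₁, hδ₁, h1⟩ := exists_sub_le_of_deriv_neg hf.smooth hf.df1
  obtain ⟨k, hk, hk0, hk1⟩ : ∃ k > 0, deriv f 0 / 2 ≤ -k ∧ deriv f 1 / 2 ≤ -k := by
    refine ⟨min (-deriv f 0 / 2) (-deriv f 1 / 2), ?_, ?_, ?_⟩
    · exact lt_min (by linarith [hf.df0]) (by linarith [hf.df1])
    · linarith [min_le_left (-deriv f 0 / 2) (-deriv f 1 / 2)]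
    · linarith [min_le_right (-deriv f 0 / 2) (-deriv f 1 / 2)]
  obtain ⟨A, hA⟩ := hUlim δ₁ hδ₁
  obtain ⟨Z, hZ⟩ := eventually_atTop.1
    (hφ.lim_top.eventually_le_const (show (0 : ℝ) < δ₀ / 2 by positivity))
  obtain ⟨T, hT⟩ := hu.past (δ₀ / 2) (by positivity)
  set T₁ := min T ((A - Z) / c) with hT₁
  have hsmall : ∀ t ≤ T₁, ∀ x ∈ closure (funnel d h), A ≤ x 0 → u t x ≤ δ₀ := by
    intro t ht x hx hAx
    have ha := (abs_le.1 (hT t (ht.trans (min_le_left _ _)) x hx)).2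
    have hb : t ≤ (A - Z) / c := ht.trans (min_le_right _ _)
    rw [le_div_iff₀ hφ.cpos] at hb
    have hc := hZ (x 0 - c * t) (by linarith)
    linarith
  have hstab : ∀ t ≤ T₁, ∀ x ∈ closure (funnel d h), U x < u t x →
      f (u t x) - f (U x) ≤ -k * (u t x - U x) := by
    intro t ht x hx hlt
    have hux := hu.range01 t x hx
    have hUx := hUrange x hx
    rcases le_total (x 0) A with hxA | hxA
    · have hUA := hA x hx hxA
      refine (h1 (u t x) ⟨by linarith, by linarith [hux.2]⟩ (U x)
        ⟨by linarith, by linarith [hUx.2]⟩ hlt.le).trans ?_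
      exact mul_le_mul_of_nonneg_right hk1 (sub_nonneg.2 hlt.le)
    · have huA := hsmall t ht x hx hxA
      refine (h0 (u t x) ⟨by linarith [hux.1], by linarith⟩ (U x)
        ⟨by linarith [hUx.1], by linarith⟩ hlt.le).trans ?_
      exact mul_le_mul_of_nonneg_right hk0 (sub_nonneg.2 hlt.le)
  have hearly : ∀ t ≤ T₁, ∀ x ∈ closure (funnel d h), u t x ≤ U x := by
    intro t ht x hx
    have hdecay : ∀ᶠ s in atBot, u t x - U x ≤ 1 * Real.exp (-k * (t - s)) := by
      filter_upwards [eventually_le_atBot t] with s hs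
      exact hu.sub_le_mul_exp hΩ hfc hU2 hUrange hUpde hUneu zero_le_one hs
        (fun r hr => hstab r (hr.2.trans ht))
        (fun y hy => by linarith [(hu.range01 s y hy).2, (hUrange y hy).1]) x hx
    have hlim : Tendsto (fun s => 1 * Real.exp (-k * (t - s))) atBot (𝓝 0) := by
      have he : ∀ s, 1 * Real.exp (-k * (t - s)) = Real.exp (k * (s - t)) := fun s => by
        rw [one_mul]; congr 1; ring
      simp only [he]
      exact Real.tendsto_exp_atBot.comp
        ((tendsto_atBot_add_const_right _ (-t) tendsto_id).const_mul_atBot hk)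
    linarith [ge_of_tendsto hlim hdecay]
  intro t x hx
  rcases le_total t T₁ with ht | ht
  · exact hearly t ht x hx
  obtain ⟨K, hK⟩ := isCompact_Icc.exists_bound_of_continuousOn (s := Icc (0 : ℝ) 1)
    (hf.smooth.continuous_deriv (by norm_num)).continuousOn
  have hlip : ∀ r ∈ Icc T₁ t, ∀ y ∈ closure (funnel d h), U y < u r y →
      f (u r y) - f (U y) ≤ -(-K) * (u r y - U y) := by
    intro r _ y hy hlt
    rw [neg_neg]
    exact (convex_Icc (0 : ℝ) 1).image_sub_le_mul_sub_of_deriv_le hfc.continuousOn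
      (hf.smooth.differentiable (by norm_num)).differentiableOn
      (fun s hs => (le_abs_self _).trans (hK s (interior_subset hs)))
      (U y) (Ioc_subset_Icc_self (hUrange y hy)) (u r y) (hu.range01 r y hy) hlt.le
  have hfin := hu.sub_le_mul_exp hΩ hfc hU2 hUrange hUpde hUneu le_rfl ht hlip
    (fun y hy => sub_nonpos.2 (hearly T₁ le_rfl y hy)) x hx
  rw [zero_mul] at hfin
  linarith
end
end

section
/- There exist R₀ > 0 and a C² function ψ on the closed Euclidean ball B̄_{R₀} ⊂ ℝ^N centered at the origin such that Δψ + f(ψ) = 0 in B̄_{R₀}, 0 ≤ ψ < 1 in B̄_{R₀}, ψ = 0 on ∂B_{R₀}, ψ is radially symmetric and nonincreasing in |x|, and max_{B̄_{R₀}} ψ = ψ(0) > θ. -/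
open Set Filter Topology MeasureTheory

noncomputable section

/-- The weighted average `∫₀¹ τ^d g(sτ) dτ`. -/
def radialAvg (d : ℕ) (g : ℝ → ℝ) (s : ℝ) : ℝ := ∫ τ in (0 : ℝ)..1, τ ^ d * g (s * τ)

/-- The radial solution, vanishing at the origin, of `Δv = g` in dimension `d + 1`. -/
def radialPotential (d : ℕ) (g : ℝ → ℝ) (r : ℝ) : ℝ := ∫ s in (0 : ℝ)..r, s * radialAvg d g s

lemma continuous_radialAvg (d : ℕ) {g : ℝ → ℝ} (hg : Continuous g) :
    Continuous (radialAvg d g) := by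
  unfold radialAvg
  apply intervalIntegral.continuous_parametric_intervalIntegral_of_continuous'
  fun_prop

lemma hasDerivAt_radialPotential (d : ℕ) {g : ℝ → ℝ} (hg : Continuous g) (r : ℝ) :
    HasDerivAt (radialPotential d g) (r * radialAvg d g r) r := by
  have hc : Continuous fun s => s * radialAvg d g s :=
    continuous_id.mul (continuous_radialAvg d hg)
  exact intervalIntegral.integral_hasDerivAt_right (hc.intervalIntegrable _ _)
    (hc.stronglyMeasurableAtFilter _ _) hc.continuousAt

lemma continuous_radialPotential (d : ℕ) {g : ℝ → ℝ} (hg : Continuous g) :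
    Continuous (radialPotential d g) :=
  continuous_iff_continuousAt.2 fun r => (hasDerivAt_radialPotential d hg r).continuousAt

lemma radialAvg_sub (d : ℕ) {g₁ g₂ : ℝ → ℝ} (h₁ : Continuous g₁) (h₂ : Continuous g₂) (s : ℝ) :
    radialAvg d (fun t => g₁ t - g₂ t) s = radialAvg d g₁ s - radialAvg d g₂ s := by
  unfold radialAvg
  rw [← intervalIntegral.integral_sub]
  · simp only [mul_sub]
  all_goals exact Continuous.intervalIntegrable (by fun_prop) _ _

lemma radialPotential_sub (d : ℕ) {g₁ g₂ : ℝ → ℝ} (h₁ : Continuous g₁) (h₂ : Continuous g₂)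
    (r : ℝ) : radialPotential d (fun t => g₁ t - g₂ t) r =
      radialPotential d g₁ r - radialPotential d g₂ r := by
  have c₁ := continuous_radialAvg d h₁
  have c₂ := continuous_radialAvg d h₂
  unfold radialPotential
  rw [← intervalIntegral.integral_sub]
  · simp only [radialAvg_sub d h₁ h₂, mul_sub]
  all_goals exact Continuous.intervalIntegrable (by fun_prop) _ _

lemma abs_radialAvg_le (d : ℕ) {g : ℝ → ℝ} {s C : ℝ}
    (h : ∀ τ ∈ Icc (0 : ℝ) 1, |g (s * τ)| ≤ C) : |radialAvg d g s| ≤ C := by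
  have := intervalIntegral.norm_integral_le_of_norm_le_const (a := 0) (b := 1) (C := C)
    (f := fun τ => τ ^ d * g (s * τ)) ?_
  · simpa [radialAvg] using this
  · intro τ hτ
    rw [uIoc_of_le zero_le_one] at hτ
    have h0 : 0 ≤ τ ^ d := pow_nonneg hτ.1.le d
    have h1 : τ ^ d ≤ 1 := pow_le_one₀ hτ.1.le hτ.2
    rw [norm_mul, Real.norm_eq_abs, Real.norm_eq_abs, abs_of_nonneg h0]
    have := h τ ⟨hτ.1.le, hτ.2⟩
    nlinarith [abs_nonneg (g (s * τ))]

lemma abs_radialPotential_le (d : ℕ) {g : ℝ → ℝ} {C l : ℝ} (hl : 0 < l)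
    (h : ∀ t, |g t| ≤ C * Real.exp (l * t ^ 2)) (r : ℝ) :
    |radialPotential d g r| ≤ C / (2 * l) * Real.exp (l * r ^ 2) := by
  have hC : 0 ≤ C := by simpa using (abs_nonneg _).trans (h 0)
  have key : radialPotential d g r = ∫ x in (0 : ℝ)..1, r * (r * x * radialAvg d g (r * x)) := by
    rw [intervalIntegral.integral_const_mul,
      intervalIntegral.mul_integral_comp_mul_left (f := fun s => s * radialAvg d g s)]
    simp [radialPotential]
  have hint : ∫ x in (0 : ℝ)..1, C * (r ^ 2 * x) * Real.exp (l * (r * x) ^ 2) =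
      C / (2 * l) * Real.exp (l * r ^ 2) - C / (2 * l) := by
    rw [intervalIntegral.integral_eq_sub_of_hasDerivAt
      (f := fun x => C / (2 * l) * Real.exp (l * (r * x) ^ 2))]
    · simp
    · intro x _
      have h1 : HasDerivAt (fun x : ℝ => l * (r * x) ^ 2) (l * (2 * (r * x) * r)) x := by
        simpa using ((((hasDerivAt_id x).const_mul r).pow 2).const_mul l)
      refine (h1.exp.const_mul (C / (2 * l))).congr_deriv ?_
      field_simp
    · exact Continuous.intervalIntegrable (by fun_prop) _ _
  have hb := intervalIntegral.norm_integral_le_of_norm_le (a := 0) (b := 1) (μ := volume)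
    (f := fun x => r * (r * x * radialAvg d g (r * x)))
    (g := fun x => C * (r ^ 2 * x) * Real.exp (l * (r * x) ^ 2)) zero_le_one
    (Eventually.of_forall fun x hx => ?_) (Continuous.intervalIntegrable (by fun_prop) _ _)
  · rw [← key, hint, Real.norm_eq_abs] at hb
    have : 0 ≤ C / (2 * l) := by positivity
    linarith
  · have hA : |radialAvg d g (r * x)| ≤ C * Real.exp (l * (r * x) ^ 2) := by
      refine abs_radialAvg_le d fun τ hτ => (h _).trans ?_
      gcongr C * Real.exp (l * ?_)
      rw [mul_pow (r * x) τ]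
      exact mul_le_of_le_one_right (sq_nonneg _) (pow_le_one₀ hτ.1 hτ.2)
    have : ‖r * (r * x * radialAvg d g (r * x))‖ = (r ^ 2 * x) * |radialAvg d g (r * x)| := by
      rw [← mul_assoc, ← mul_assoc, norm_mul, ← pow_two, Real.norm_eq_abs, Real.norm_eq_abs,
        abs_of_nonneg (mul_nonneg (sq_nonneg r) hx.1.le)]
    rw [this]
    calc _ ≤ r ^ 2 * x * (C * Real.exp (l * (r * x) ^ 2)) :=
          mul_le_mul_of_nonneg_left hA (mul_nonneg (sq_nonneg r) hx.1.le)
      _ = _ := by ring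

/-- Global solvability of the radial Cauchy problem, in integral form. -/
lemma exists_radial_solution (d : ℕ) {f : ℝ → ℝ} {K : NNReal} (hf : LipschitzWith K f)
    (f0 : f 0 = 0) (a : ℝ) :
    ∃ u : ℝ → ℝ, Continuous u ∧ ∀ r, u r = a - radialPotential d (fun t => f (u t)) r := by
  set l : ℝ := K + 1 with hl
  have hl0 : 0 < l := by positivity
  let up : (BoundedContinuousFunction ℝ ℝ) → ℝ → ℝ := fun v t => Real.exp (l * t ^ 2) * v t
  have hup (v) : Continuous (up v) := by fun_prop
  have hfup (v) : Continuous fun t => f (up v t) := hf.continuous.comp (hup v)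
  have hexp (r : ℝ) : Real.exp (-(l * r ^ 2)) * Real.exp (l * r ^ 2) = 1 := by
    rw [← Real.exp_add]; simp
  have hdiff (v w : BoundedContinuousFunction ℝ ℝ) (t : ℝ) :
      |f (up v t) - f (up w t)| ≤ K * dist v w * Real.exp (l * t ^ 2) := by
    have h1 := hf.dist_le_mul (up v t) (up w t)
    rw [Real.dist_eq, Real.dist_eq, ← mul_sub, abs_mul, abs_of_pos (Real.exp_pos _)] at h1
    have h2 : |v t - w t| ≤ dist v w := v.dist_coe_le_dist t
    calc _ ≤ _ := h1
      _ ≤ K * (Real.exp (l * t ^ 2) * dist v w) := by gcongr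
      _ = _ := by ring
  have hdiffP (v w : BoundedContinuousFunction ℝ ℝ) (r : ℝ) :
      Real.exp (-(l * r ^ 2)) * |radialPotential d (fun t => f (up v t)) r -
        radialPotential d (fun t => f (up w t)) r| ≤ K * dist v w / (2 * l) := by
    rw [← radialPotential_sub d (hfup v) (hfup w)]
    calc _ ≤ Real.exp (-(l * r ^ 2)) * (K * dist v w / (2 * l) * Real.exp (l * r ^ 2)) := by
          gcongr
          exact abs_radialPotential_le d hl0 (hdiff v w) r
      _ = K * dist v w / (2 * l) * (Real.exp (-(l * r ^ 2)) * Real.exp (l * r ^ 2)) := by ring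
      _ = _ := by rw [hexp, mul_one]
  have hP0 (r : ℝ) : radialPotential d (fun t => f (up 0 t)) r = 0 := by
    simp [up, f0, radialPotential, radialAvg]
  let T : BoundedContinuousFunction ℝ ℝ → BoundedContinuousFunction ℝ ℝ := fun v =>
    BoundedContinuousFunction.ofNormedAddCommGroup
      (fun r => Real.exp (-(l * r ^ 2)) * (a - radialPotential d (fun t => f (up v t)) r))
      (by have := continuous_radialPotential d (hfup v); fun_prop)
      (|a| + K * dist v 0 / (2 * l)) (fun r => by
        have h1 := hdiffP v 0 r
        rw [hP0, sub_zero] at h1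
        rw [norm_mul, Real.norm_eq_abs, Real.norm_eq_abs, abs_of_pos (Real.exp_pos _)]
        have h2 : Real.exp (-(l * r ^ 2)) ≤ 1 := by
          rw [Real.exp_le_one_iff]; nlinarith [sq_nonneg r]
        have h3 := abs_sub a (radialPotential d (fun t => f (up v t)) r)
        have h4 := mul_le_mul_of_nonneg_left h3 (Real.exp_pos (-(l * r ^ 2))).le
        have h5 := mul_le_mul_of_nonneg_right h2 (abs_nonneg a)
        linarith)
  have hT : ContractingWith (1 / 2) T := by
    refine ⟨by
      rw [← NNReal.coe_lt_coe]; norm_num, LipschitzWith.of_dist_le_mul fun v w => ?_⟩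
    rw [BoundedContinuousFunction.dist_le (by positivity)]
    intro r
    have h1 := hdiffP v w r
    have h2 : dist (T v r) (T w r) = Real.exp (-(l * r ^ 2)) *
        |radialPotential d (fun t => f (up v t)) r -
          radialPotential d (fun t => f (up w t)) r| := by
      simp only [T, BoundedContinuousFunction.coe_ofNormedAddCommGroup, Real.dist_eq]
      rw [← mul_sub, abs_mul, abs_of_pos (Real.exp_pos _), abs_sub_comm]
      congr 2; ring
    rw [h2]
    refine h1.trans ?_
    rw [div_le_iff₀ (by positivity)]
    push_cast
    have := dist_nonneg (x := v) (y := w)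
    nlinarith
  set v := hT.fixedPoint T
  have hv : T v = v := hT.fixedPoint_isFixedPt
  refine ⟨up v, hup v, fun r => ?_⟩
  have h1 : v r = Real.exp (-(l * r ^ 2)) *
      (a - radialPotential d (fun t => f (up v t)) r) := by
    conv_lhs => rw [← hv]
    rfl
  have h2 : up v r = Real.exp (l * r ^ 2) * v r := rfl
  rw [h2, h1, ← mul_assoc, mul_comm (Real.exp (l * r ^ 2)), hexp, one_mul]

lemma hasDerivAt_radial_solution {d : ℕ} {f u : ℝ → ℝ} {a : ℝ} (hf : Continuous f)
    (hu : Continuous u) (hsol : ∀ r, u r = a - radialPotential d (fun t => f (u t)) r) (r : ℝ) :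
    HasDerivAt u (-(r * radialAvg d (fun t => f (u t)) r)) r := by
  have hfu : Continuous fun t => f (u t) := hf.comp hu
  have := (hasDerivAt_radialPotential d hfu r).const_sub a
  rwa [← funext hsol] at this

lemma pow_mul_radialAvg (d : ℕ) (g : ℝ → ℝ) (s : ℝ) :
    s ^ d * (s * radialAvg d g s) = ∫ t in (0 : ℝ)..s, t ^ d * g t := by
  have h := intervalIntegral.mul_integral_comp_mul_left (a := 0) (b := 1)
    (f := fun t => t ^ d * g t) (c := s)
  rw [mul_zero, mul_one] at h
  rw [← h, radialAvg]
  simp only [mul_pow, mul_assoc]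
  rw [intervalIntegral.integral_const_mul]
  ring

lemma hasDerivAt_mul_radialAvg (d : ℕ) {g : ℝ → ℝ} (hg : Continuous g) {r : ℝ} (hr : r ≠ 0) :
    HasDerivAt (fun s => s * radialAvg d g s) (g r - d * radialAvg d g r) r := by
  have hc : Continuous fun t => t ^ d * g t := by fun_prop
  have h1 : HasDerivAt (fun s => ∫ t in (0 : ℝ)..s, t ^ d * g t) (r ^ d * g r) r :=
    intervalIntegral.integral_hasDerivAt_right (hc.intervalIntegrable _ _)
      (hc.stronglyMeasurableAtFilter _ _) hc.continuousAt
  have h2 := h1.div (hasDerivAt_pow d r) (pow_ne_zero d hr)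
  refine (h2.congr_of_eventuallyEq ?_).congr_deriv ?_
  · filter_upwards [isOpen_ne.mem_nhds hr] with s hs
    rw [Pi.div_apply, ← pow_mul_radialAvg]
    field_simp [pow_ne_zero d hs]
  · rw [← pow_mul_radialAvg]
    rcases d with _ | n
    · simp
    · have : n + 1 - 1 = n := rfl
      rw [this]
      field_simp
      ring

lemma hasDerivAt_primitive {f : ℝ → ℝ} (hf : Continuous f) (s : ℝ) :
    HasDerivAt (fun x => ∫ t in (0 : ℝ)..x, f t) (f s) s :=
  intervalIntegral.integral_hasDerivAt_right (hf.intervalIntegrable _ _)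
    (hf.stronglyMeasurableAtFilter _ _) hf.continuousAt

lemma Bistable.monotoneOn_primitive {f : ℝ → ℝ} {θ : ℝ} (hf : Bistable f θ) :
    MonotoneOn (fun x => ∫ t in (0 : ℝ)..x, f t) (Icc θ 1) := by
  have hD := hasDerivAt_primitive hf.smooth.continuous
  refine monotoneOn_of_deriv_nonneg (convex_Icc _ _)
    (fun x _ => (hD x).continuousAt.continuousWithinAt)
    (fun x _ => (hD x).differentiableAt.differentiableWithinAt) fun x hx => ?_
  rw [interior_Icc] at hx
  rw [(hD x).deriv]
  exact (hf.pos x hx).le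

lemma Bistable.exists_primitive_nonpos {f : ℝ → ℝ} {θ : ℝ} (hf : Bistable f θ) :
    ∃ l ∈ Ioo θ 1, ∀ s ∈ Icc 0 l, ∫ t in (0 : ℝ)..s, f t ≤ 0 := by
  have hD := hasDerivAt_primitive hf.smooth.continuous
  have hanti : StrictAntiOn (fun x => ∫ t in (0 : ℝ)..x, f t) (Icc 0 θ) := by
    refine strictAntiOn_of_deriv_neg (convex_Icc _ _)
      (fun x _ => (hD x).continuousAt.continuousWithinAt) fun x hx => ?_
    rw [interior_Icc] at hx
    rw [(hD x).deriv]
    exact hf.neg x hx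
  have hθ := hf.θmem
  have h0 : ∫ t in (0 : ℝ)..θ, f t < 0 := by
    simpa using hanti (left_mem_Icc.2 hθ.1.le) (right_mem_Icc.2 hθ.1.le) hθ.1
  have hev : ∀ᶠ x in 𝓝[>] θ, ∫ t in (0 : ℝ)..x, f t < 0 :=
    ((hD θ).continuousAt.eventually_lt continuousAt_const h0).filter_mono nhdsWithin_le_nhds
  obtain ⟨l, hl, hl'⟩ := (hev.and (Ioo_mem_nhdsGT hθ.2)).exists
  refine ⟨l, hl', fun s hs => ?_⟩
  rcases le_total s θ with h | h
  · simpa using hanti.antitoneOn (left_mem_Icc.2 hθ.1.le) ⟨hs.1, h⟩ hs.1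
  · exact (hf.monotoneOn_primitive ⟨h, hs.2.trans hl'.2.le⟩ ⟨hl'.1.le, hl'.2.le⟩ hs.2).trans hl.le

lemma Bistable.exists_primitive_pos {f : ℝ → ℝ} {θ : ℝ} (hf : Bistable f θ) :
    ∃ b ∈ Ioo θ 1, 0 < ∫ t in (0 : ℝ)..b, f t := by
  have hev : ∀ᶠ x in 𝓝[<] (1 : ℝ), 0 < ∫ t in (0 : ℝ)..x, f t :=
    (continuousAt_const.eventually_lt
      (hasDerivAt_primitive hf.smooth.continuous 1).continuousAt hf.mass).filter_mono
        nhdsWithin_le_nhds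
  obtain ⟨b, hb, hb'⟩ := (hev.and (Ioo_mem_nhdsLT hf.θmem.2)).exists
  exact ⟨b, hb', hb⟩

lemma Bistable.exists_lipschitzWith {f : ℝ → ℝ} {θ : ℝ} (hf : Bistable f θ) :
    ∃ K : NNReal, LipschitzWith K f := by
  have hc : Continuous (deriv f) := hf.smooth.continuous_deriv le_rfl
  obtain ⟨C, hC⟩ := isCompact_Icc.exists_bound_of_continuousOn
    (s := Icc (0 : ℝ) 1) hc.continuousOn
  have hC0 : 0 ≤ C := (norm_nonneg _).trans (hC 0 (by simp))
  refine ⟨C.toNNReal, lipschitzWith_of_nnnorm_deriv_le (hf.smooth.differentiable one_ne_zero)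
    fun x => ?_⟩
  rw [← NNReal.coe_le_coe, Real.coe_toNNReal C hC0, coe_nnnorm]
  rcases lt_or_ge x 0 with hx | hx
  · have : f =ᶠ[𝓝 x] fun s => deriv f 0 * s := by
      filter_upwards [Iio_mem_nhds hx] with s hs using hf.ext_neg s hs
    rw [this.deriv_eq]
    simpa using hC 0 (by simp)
  rcases lt_or_ge 1 x with hx1 | hx1
  · have : f =ᶠ[𝓝 x] fun s => deriv f 1 * (s - 1) := by
      filter_upwards [Ioi_mem_nhds hx1] with s hs using hf.ext_pos s hs
    rw [this.deriv_eq]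
    simpa using hC 1 (by simp)
  · exact hC x ⟨hx, hx1⟩

/-- A lower bound for the speed of descent of a radial solution that has remained nonnegative and
nonincreasing up to radius `R`, when its initial value is close enough to `1`. -/
lemma Bistable.radial_descent {f : ℝ → ℝ} {θ : ℝ} (hf : Bistable f θ) {K : NNReal}
    (hK : LipschitzWith K f) {d : ℕ} {u : ℝ → ℝ} {a b l m ρ R : ℝ} (hu : Continuous u)
    (hsol : ∀ r, u r = a - radialPotential d (fun t => f (u t)) r)
    (hb : b ∈ Ioo θ 1) (ha : a ∈ Ioo b 1) (hρ : 0 < ρ)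
    (hgrow : (1 - a) * Real.exp (K * ρ ^ 2 / 2) ≤ 1 - b)
    (hloss : d * ((2 * K + 1) / ρ) ≤ (∫ t in (0 : ℝ)..b, f t) / 2)
    (hFb : 0 < ∫ t in (0 : ℝ)..b, f t)
    (hl : ∀ s ∈ Icc 0 l, ∫ t in (0 : ℝ)..s, f t ≤ 0)
    (hm : ∀ s ∈ Icc l a, m ≤ f s) (hR0 : 0 ≤ R)
    (hR : ∀ r ∈ Icc 0 R, 0 ≤ u r ∧ 0 ≤ radialAvg d (fun t => f (u t)) r) :
    (∫ t in (0 : ℝ)..b, f t) ≤ (R * radialAvg d (fun t => f (u t)) R) ^ 2 ∨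
      m / (d + 1) ≤ radialAvg d (fun t => f (u t)) R := by
  set g : ℝ → ℝ := fun t => f (u t) with hgdef
  set F : ℝ → ℝ := fun x => ∫ t in (0 : ℝ)..x, f t with hF
  set h : ℝ → ℝ := radialAvg d g with hh
  have hg : Continuous g := hK.continuous.comp hu
  have hhc : Continuous h := continuous_radialAvg d hg
  have hFd : ∀ s, HasDerivAt F (f s) s := hasDerivAt_primitive hK.continuous
  have hFc : Continuous F := continuous_iff_continuousAt.2 fun s => (hFd s).continuousAt
  have hud (r : ℝ) : HasDerivAt u (-(r * h r)) r :=
    hasDerivAt_radial_solution hK.continuous hu hsol r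
  have hu0 : u 0 = a := by simp [hsol 0, radialPotential]
  have hK0 : (0 : ℝ) ≤ K := K.2
  have huanti : AntitoneOn u (Icc 0 R) := by
    refine antitoneOn_of_deriv_nonpos (convex_Icc _ _) hu.continuousOn
      (fun x _ => (hud x).differentiableAt.differentiableWithinAt) fun x hx => ?_
    rw [(hud x).deriv]
    have hx' := interior_subset hx
    have := mul_nonneg hx'.1 (hR x hx').2
    linarith
  have hule {r : ℝ} (hr : r ∈ Icc 0 R) : u r ≤ a :=
    hu0 ▸ huanti (left_mem_Icc.2 hR0) hr hr.1
  -- the energy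
  let E : ℝ → ℝ := fun r => (r * h r) ^ 2 / 2 + F (u r)
  have hEc : Continuous E := by fun_prop
  have hEd {r : ℝ} (hr : r ≠ 0) : HasDerivAt E (-(d * (r * h r ^ 2))) r := by
    have h1 := ((hasDerivAt_mul_radialAvg d hg hr).pow 2).div_const 2
    have h2 := (hFd (u r)).comp r (hud r)
    refine (h1.add h2).congr_deriv ?_
    simp only [hgdef]
    push_cast
    ring
  have hEanti : AntitoneOn E (Icc 0 R) := by
    refine antitoneOn_of_deriv_nonpos (convex_Icc _ _) hEc.continuousOn ?_ ?_ <;>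
    · intro x hx
      rw [interior_Icc] at hx
      have hd := hEd hx.1.ne'
      first
        | exact hd.differentiableAt.differentiableWithinAt
        | rw [hd.deriv]
          have := hx.1
          exact neg_nonpos.2 (by positivity)
  have hspeed {r : ℝ} (hr : r ∈ Icc 0 R) : r * h r ≤ 2 * K + 1 := by
    have h1 : E r ≤ F a := by
      have := hEanti (left_mem_Icc.2 hR0) hr hr.1
      simpa [E, hu0] using this
    have h2 : F a - F (u r) ≤ K := by
      have hI : F a - F (u r) = ∫ t in (u r)..a, f t :=
        intervalIntegral.integral_interval_sub_left (hK.continuous.intervalIntegrable _ _)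
          (hK.continuous.intervalIntegrable _ _)
      rw [hI]
      have hB := intervalIntegral.norm_integral_le_of_norm_le_const (a := u r) (b := a) (f := f)
        (C := K) fun x hx => by
          rw [uIoc_of_le (hule hr)] at hx
          have h3 := hK.dist_le_mul x 0
          rw [hf.f0, Real.dist_eq, Real.dist_eq, sub_zero, sub_zero] at h3
          have hx0 : 0 ≤ x := (hR r hr).1.trans hx.1.le
          rw [abs_of_nonneg hx0] at h3
          rw [Real.norm_eq_abs]
          have : x ≤ 1 := hx.2.trans ha.2.le
          nlinarith
      have h4 := (le_abs_self _).trans hB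
      rw [abs_of_nonneg (sub_nonneg.2 (hule hr))] at h4
      have := (hR r hr).1
      have := ha.2
      nlinarith
    have h3 : (r * h r) ^ 2 / 2 + F (u r) ≤ F a := h1
    nlinarith
  have hnear {r : ℝ} (hr : r ∈ Icc 0 R) (hrρ : r ≤ ρ) : b ≤ u r := by
    let w : ℝ → ℝ := fun x => (1 - u x) * Real.exp (-(K * x ^ 2 / 2))
    have hwd (x : ℝ) : HasDerivAt w
        ((x * h x - K * x * (1 - u x)) * Real.exp (-(K * x ^ 2 / 2))) x := by
      have h1 : HasDerivAt (fun x : ℝ => -(K * x ^ 2 / 2)) (-(K * x)) x := by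
        refine ((((hasDerivAt_id x).pow 2).const_mul (K : ℝ)).div_const 2).neg.congr_deriv ?_
        simp
        ring
      refine (((hud x).const_sub 1).mul h1.exp).congr_deriv ?_
      ring
    have hwanti : AntitoneOn w (Icc 0 R) := by
      refine antitoneOn_of_deriv_nonpos (convex_Icc _ _)
        (fun x _ => (hwd x).continuousAt.continuousWithinAt)
        (fun x _ => (hwd x).differentiableAt.differentiableWithinAt) fun x hx => ?_
      rw [(hwd x).deriv]
      have hx := interior_subset hx
      have h1 : h x ≤ K * (1 - u x) := by
        refine (le_abs_self _).trans (abs_radialAvg_le d fun τ hτ => ?_)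
        have hxτ : x * τ ≤ x := mul_le_of_le_one_right hx.1 hτ.2
        have hmem : x * τ ∈ Icc 0 R := ⟨mul_nonneg hx.1 hτ.1, hxτ.trans hx.2⟩
        have h3 := hK.dist_le_mul (u (x * τ)) 1
        have h4 : 0 ≤ 1 - u (x * τ) := by linarith [hule hmem, ha.2]
        rw [hf.f1, Real.dist_eq, Real.dist_eq, sub_zero, abs_sub_comm _ (1 : ℝ),
          abs_of_nonneg h4] at h3
        refine h3.trans ?_
        gcongr
        exact huanti hmem hx hxτ
      have h2 := mul_le_mul_of_nonneg_left h1 hx.1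
      exact mul_nonpos_of_nonpos_of_nonneg (by linarith) (Real.exp_pos _).le
    have h1 : w r ≤ 1 - a := by
      have := hwanti (left_mem_Icc.2 hR0) hr hr.1
      simpa [w, hu0] using this
    have h2 : 1 - u r = w r * Real.exp (K * r ^ 2 / 2) := by
      simp only [w]
      rw [mul_assoc, ← Real.exp_add]
      simp
    have h3 : Real.exp (K * r ^ 2 / 2) ≤ Real.exp (K * ρ ^ 2 / 2) := by
      have := hr.1
      gcongr
    have h4 : w r * Real.exp (K * r ^ 2 / 2) ≤ (1 - a) * Real.exp (K * ρ ^ 2 / 2) :=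
      mul_le_mul h1 h3 (Real.exp_pos _).le (by linarith [ha.2])
    linarith
  have hFnear {r : ℝ} (hr : r ∈ Icc 0 R) (hrρ : r ≤ ρ) : F b ≤ F (u r) :=
    hf.monotoneOn_primitive ⟨hb.1.le, hb.2.le⟩
      ⟨hb.1.le.trans (hnear hr hrρ), (hule hr).trans ha.2.le⟩ (hnear hr hrρ)
  have hRmem : R ∈ Icc 0 R := right_mem_Icc.2 hR0
  have henergy : F b / 2 ≤ E R := by
    rcases le_total R ρ with hRρ | hRρ
    · have h1 := hFnear hRmem hRρ
      have h2 : E R = (R * h R) ^ 2 / 2 + F (u R) := rfl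
      have h3 : 0 < F b := hFb
      nlinarith [sq_nonneg (R * h R)]
    · set c : ℝ := d * ((2 * K + 1) / ρ) with hc
      have hc0 : 0 ≤ c := by positivity
      have hmono : MonotoneOn (fun r => E r - c * u r) (Icc ρ R) := by
        have hd {x : ℝ} (hx : 0 < x) : HasDerivAt (fun r => E r - c * u r)
            (x * h x * (c - d * h x)) x := by
          refine ((hEd hx.ne').sub ((hud x).const_mul c)).congr_deriv ?_
          ring
        refine monotoneOn_of_deriv_nonneg (convex_Icc _ _) (by fun_prop) ?_ ?_
        · intro x hx
          have hx := interior_subset hx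
          exact (hd (hρ.trans_le hx.1)).differentiableAt.differentiableWithinAt
        · intro x hx
          have hx := interior_subset hx
          have hx0 := hρ.trans_le hx.1
          have hxm : x ∈ Icc 0 R := ⟨hx0.le, hx.2⟩
          have hhx := (hR x hxm).2
          rw [(hd hx0).deriv]
          have h1 : h x ≤ (2 * K + 1) / ρ := by
            rw [le_div_iff₀ hρ]
            have := hspeed hxm
            have := mul_le_mul_of_nonneg_right hx.1 hhx
            linarith
          have h2 : d * h x ≤ c := by
            rw [hc]
            gcongr
          exact mul_nonneg (mul_nonneg hx0.le hhx) (by linarith)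
      have hρm : ρ ∈ Icc 0 R := ⟨hρ.le, hRρ⟩
      have h1 : E ρ - c * u ρ ≤ E R - c * u R :=
        hmono (left_mem_Icc.2 hRρ) (right_mem_Icc.2 hRρ) hRρ
      have h2 := hFnear hρm le_rfl
      have h3 : E ρ = (ρ * h ρ) ^ 2 / 2 + F (u ρ) := rfl
      have h4 : u ρ ≤ 1 := (hule hρm).trans ha.2.le
      have h5 := (hR R hRmem).1
      have h6 : c ≤ F b / 2 := hloss
      nlinarith [sq_nonneg (ρ * h ρ)]
  rcases le_total (u R) l with hul | hul
  · left
    have h1 : F (u R) ≤ 0 := hl _ ⟨(hR R hRmem).1, hul⟩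
    have h2 : E R = (R * h R) ^ 2 / 2 + F (u R) := rfl
    change F b ≤ _
    linarith
  · right
    have hint : ∫ τ in (0 : ℝ)..1, τ ^ d * m = m / (d + 1) := by
      rw [intervalIntegral.integral_mul_const, integral_pow]
      simp
      ring
    rw [← hint]
    refine intervalIntegral.integral_mono_on zero_le_one
      (Continuous.intervalIntegrable (by fun_prop) _ _)
      (Continuous.intervalIntegrable (by fun_prop) _ _) fun τ hτ => ?_
    have hRτ : R * τ ≤ R := mul_le_of_le_one_right hR0 hτ.2
    have hmem : R * τ ∈ Icc 0 R := ⟨mul_nonneg hR0 hτ.1, hRτ⟩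
    exact mul_le_mul_of_nonneg_left
      (hm _ ⟨hul.trans (huanti hmem hRmem hRτ), hule hmem⟩) (pow_nonneg hτ.1 d)

/-- The shooting argument: a suitable radial solution decreases down to `0` in finite time. -/
lemma Bistable.exists_shooting {f : ℝ → ℝ} {θ : ℝ} (hf : Bistable f θ) (d : ℕ) :
    ∃ a ∈ Ioo θ 1, ∃ u : ℝ → ℝ, Continuous u ∧
      (∀ r, u r = a - radialPotential d (fun t => f (u t)) r) ∧
      ∃ R > 0, u R = 0 ∧
        ∀ r ∈ Icc 0 R, 0 ≤ u r ∧ 0 ≤ radialAvg d (fun t => f (u t)) r := by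
  obtain ⟨K, hK⟩ := hf.exists_lipschitzWith
  obtain ⟨l, hl, hFl⟩ := hf.exists_primitive_nonpos
  obtain ⟨b, hb, hFb⟩ := hf.exists_primitive_pos
  set e := ∫ t in (0 : ℝ)..b, f t
  set ρ : ℝ := (d + 1) * (2 * (2 * K + 1)) / e with hρdef
  have hρ : 0 < ρ := by positivity
  have hloss : d * ((2 * K + 1) / ρ) ≤ e / 2 := by
    have : (2 * K + 1) / ρ = e / (2 * (d + 1)) := by
      rw [hρdef]
      field_simp
    rw [this, mul_div_assoc', div_le_div_iff₀ (by positivity) two_pos]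
    nlinarith
  have hev : ∀ᶠ a in 𝓝[<] (1 : ℝ), (1 - a) * Real.exp (K * ρ ^ 2 / 2) < 1 - b := by
    have hc : ContinuousAt (fun a : ℝ => (1 - a) * Real.exp (K * ρ ^ 2 / 2)) 1 := by fun_prop
    exact (hc.eventually_lt continuousAt_const (by simpa using hb.2)).filter_mono
      nhdsWithin_le_nhds
  obtain ⟨a, hgrow, ha⟩ := (hev.and (Ioo_mem_nhdsLT (max_lt hb.2 hl.2))).exists
  have hab : a ∈ Ioo b 1 := ⟨(le_max_left _ _).trans_lt ha.1, ha.2⟩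
  have hal : l ≤ a := (le_max_right _ _).trans ha.1.le
  obtain ⟨s₀, hs₀, hmin⟩ := isCompact_Icc.exists_isMinOn (nonempty_Icc.2 hal)
    hK.continuous.continuousOn
  set m := f s₀
  have hm0 : 0 < m := hf.pos s₀ ⟨hl.1.trans_le hs₀.1, hs₀.2.trans_lt ha.2⟩
  obtain ⟨u, hu, hsol⟩ := exists_radial_solution d hK hf.f0 a
  refine ⟨a, ⟨hb.1.trans hab.1, ha.2⟩, u, hu, hsol, ?_⟩
  set h : ℝ → ℝ := radialAvg d (fun t => f (u t))
  have hg : Continuous fun t => f (u t) := hK.continuous.comp hu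
  have hhc : Continuous h := continuous_radialAvg d hg
  have hud (r : ℝ) : HasDerivAt u (-(r * h r)) r :=
    hasDerivAt_radial_solution hK.continuous hu hsol r
  have hu0 : u 0 = a := by simp [hsol 0, radialPotential]
  have hdesc {R : ℝ} (hR0 : 0 ≤ R) (hR : ∀ r ∈ Icc 0 R, 0 ≤ u r ∧ 0 ≤ h r) :
      e ≤ (R * h R) ^ 2 ∨ m / (d + 1) ≤ h R :=
    hf.radial_descent hK hu hsol hb hab hρ hgrow.le hloss hFb hFl (fun s hs => hmin hs) hR0 hR
  have hmd : 0 < m / (d + 1) := by positivity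
  have hpos {R : ℝ} (hR0 : 0 ≤ R) (hR : ∀ r ∈ Icc 0 R, 0 ≤ u r ∧ 0 ≤ h r) : 0 < h R := by
    rcases hdesc hR0 hR with h1 | h1
    · refine (hR R (right_mem_Icc.2 hR0)).2.lt_of_ne fun h2 => ?_
      rw [← h2] at h1
      simp only [mul_zero, ne_eq, OfNat.ofNat_ne_zero, not_false_eq_true, zero_pow] at h1
      linarith
    · exact hmd.trans_le h1
  by_contra! hno
  let S : Set ℝ := {r | 0 ≤ u r ∧ 0 ≤ h r}
  have hS : IsClosed S :=
    (isClosed_le continuous_const hu).inter (isClosed_le continuous_const hhc)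
  have ha0 : 0 < a := hf.θmem.1.trans (hb.1.trans hab.1)
  have h0S : (0 : ℝ) ∈ S := by
    refine ⟨hu0 ▸ ha0.le, ?_⟩
    refine intervalIntegral.integral_nonneg zero_le_one fun τ hτ => ?_
    simp only [zero_mul, hu0]
    exact mul_nonneg (pow_nonneg hτ.1 d) (hf.pos a ⟨hb.1.trans hab.1, ha.2⟩).le
  have hall (X : ℝ) : Icc 0 X ⊆ S := by
    refine (hS.inter isClosed_Icc).Icc_subset_of_forall_mem_nhdsGT_of_Icc_subset h0S
      fun r hr hrS => ?_
    have hhr : 0 < h r := hpos hr.1 hrS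
    have hur : 0 < u r := by
      refine (hrS (right_mem_Icc.2 hr.1)).1.lt_of_ne fun h1 => ?_
      rcases hr.1.eq_or_lt with h2 | h2
      · rw [← h2, hu0] at h1
        exact ha0.ne h1
      · obtain ⟨x, hx, hx'⟩ := hno r h2 h1.symm
        exact absurd (hrS hx).2 (not_le.2 (hx' (hrS hx).1))
    refine nhdsWithin_le_nhds ?_
    filter_upwards [continuousAt_const.eventually_lt hu.continuousAt hur,
      continuousAt_const.eventually_lt hhc.continuousAt hhr] with x hx hx'
    exact ⟨hx.le, hx'.le⟩
  set c : ℝ := min (Real.sqrt e) (m / (d + 1))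
  have hc0 : 0 < c := lt_min (Real.sqrt_pos.2 hFb) hmd
  have hrate {r : ℝ} (hr : 1 ≤ r) : c ≤ r * h r := by
    have hr0 : 0 ≤ r := zero_le_one.trans hr
    have hhr := (hall r (right_mem_Icc.2 hr0)).2
    rcases hdesc hr0 (hall r) with h1 | h1
    · exact (min_le_left _ _).trans (Real.sqrt_le_iff.2 ⟨mul_nonneg hr0 hhr, h1⟩)
    · refine (min_le_right _ _).trans (h1.trans ?_)
      nlinarith
  have hanti : AntitoneOn (fun r => u r + c * r) (Ici 1) := by
    have hd (r : ℝ) : HasDerivAt (fun r => u r + c * r) (-(r * h r) + c) r := by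
      refine ((hud r).add ((hasDerivAt_id r).const_mul c)).congr_deriv ?_
      rw [mul_one]
    refine antitoneOn_of_deriv_nonpos (convex_Ici _)
      (fun r _ => (hd r).continuousAt.continuousWithinAt)
      (fun r _ => (hd r).differentiableAt.differentiableWithinAt) fun r hr => ?_
    rw [(hd r).deriv]
    linarith [hrate (interior_subset hr)]
  have hu1 : AntitoneOn u (Icc 0 1) := by
    refine antitoneOn_of_deriv_nonpos (convex_Icc _ _) hu.continuousOn
      (fun r _ => (hud r).differentiableAt.differentiableWithinAt) fun r hr => ?_
    have hr := interior_subset hr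
    rw [(hud r).deriv]
    exact neg_nonpos.2 (mul_nonneg hr.1 (hall 1 hr).2)
  have h1 : u 1 ≤ a := hu0 ▸ hu1 (by simp) (by simp) zero_le_one
  have h2 : 0 < 2 / c := by positivity
  have h3 := hanti (mem_Ici.2 le_rfl) (mem_Ici.2 (by linarith : 1 ≤ 1 + 2 / c)) (by linarith)
  have h4 : c * (1 + 2 / c) = c + 2 := by field_simp
  have h5 := (hall (1 + 2 / c) (right_mem_Icc.2 (by linarith))).1
  simp only [h4, mul_one] at h3
  linarith [ha.2]

section Average

variable {E : Type*} [NormedAddCommGroup E] [NormedSpace ℝ E]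

/-- The derivative of the weighted average `x ↦ ∫₀¹ τ^d g(τx) dτ` of a `C¹` function `g`. -/
lemma hasFDerivAt_average [ProperSpace E] (d : ℕ) {g : E → ℝ} (hg : ContDiff ℝ 1 g) (x : E) :
    HasFDerivAt (fun x => ∫ τ in (0 : ℝ)..1, τ ^ d * g (τ • x))
      (∫ τ in (0 : ℝ)..1, (τ ^ d * τ) • fderiv ℝ g (τ • x)) x := by
  have hgc := hg.continuous
  have hg' : Continuous (fderiv ℝ g) := hg.continuous_fderiv one_ne_zero
  obtain ⟨C, hC⟩ := (isCompact_closedBall (0 : E) (‖x‖ + 1)).exists_bound_of_continuousOn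
    hg'.continuousOn
  have hdiff (t : ℝ) (y : E) : HasFDerivAt (fun x => t ^ d * g (t • x))
      ((t ^ d * t) • fderiv ℝ g (t • y)) y := by
    have h1 := ((hg.differentiable one_ne_zero) (t • y)).hasFDerivAt
    have h2 := (h1.comp y ((hasFDerivAt_id y).const_smul t)).const_mul (t ^ d)
    refine h2.congr_fderiv ?_
    ext v
    simp [mul_assoc]
  refine intervalIntegral.hasFDerivAt_integral_of_dominated_of_fderiv_le
    (F := fun x τ => τ ^ d * g (τ • x)) (F' := fun x τ => (τ ^ d * τ) • fderiv ℝ g (τ • x))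
    (bound := fun _ => C) (Metric.ball_mem_nhds x one_pos) ?_ ?_ ?_ ?_ ?_ ?_
  · exact Eventually.of_forall fun y => Continuous.aestronglyMeasurable (by fun_prop)
  · exact Continuous.intervalIntegrable (by fun_prop) _ _
  · exact Continuous.aestronglyMeasurable (by fun_prop)
  · refine Eventually.of_forall fun t ht y hy => ?_
    rw [uIoc_of_le zero_le_one] at ht
    have hy' : ‖y‖ ≤ ‖x‖ + 1 := by
      have := norm_le_norm_add_norm_sub' y x
      rw [mem_ball_iff_norm] at hy
      linarith
    have ht0 : 0 ≤ t ^ d * t := mul_nonneg (pow_nonneg ht.1.le d) ht.1.le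
    have ht1 : t ^ d * t ≤ 1 := by
      rw [← pow_succ]
      exact pow_le_one₀ ht.1.le ht.2
    have h1 : ‖fderiv ℝ g (t • y)‖ ≤ C := by
      refine hC _ ?_
      rw [mem_closedBall_zero_iff, norm_smul, Real.norm_eq_abs, abs_of_pos ht.1]
      exact (mul_le_of_le_one_left (norm_nonneg y) ht.2).trans hy'
    rw [norm_smul, Real.norm_eq_abs, abs_of_nonneg ht0]
    exact (mul_le_of_le_one_left (norm_nonneg _) ht1).trans h1
  · exact intervalIntegrable_const
  · exact Eventually.of_forall fun t _ y _ => hdiff t y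

lemma contDiff_average [ProperSpace E] (d : ℕ) {g : E → ℝ} (hg : ContDiff ℝ 1 g) :
    ContDiff ℝ 1 (fun x => ∫ τ in (0 : ℝ)..1, τ ^ d * g (τ • x)) := by
  have hg' : Continuous (fderiv ℝ g) := hg.continuous_fderiv one_ne_zero
  rw [contDiff_one_iff_hasFDerivAt]
  refine ⟨_, ?_, hasFDerivAt_average d hg⟩
  apply intervalIntegral.continuous_parametric_intervalIntegral_of_continuous'
  fun_prop

/-- Euler's identity for the weighted average `x ↦ ∫₀¹ τ^d g(τx) dτ`. -/
lemma fderiv_average_self [ProperSpace E] (d : ℕ) {g : E → ℝ} (hg : ContDiff ℝ 1 g) (x : E) :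
    fderiv ℝ (fun x => ∫ τ in (0 : ℝ)..1, τ ^ d * g (τ • x)) x x =
      g x - (d + 1) * ∫ τ in (0 : ℝ)..1, τ ^ d * g (τ • x) := by
  have hgc := hg.continuous
  have hg' : Continuous (fderiv ℝ g) := hg.continuous_fderiv one_ne_zero
  rw [(hasFDerivAt_average d hg x).fderiv, ContinuousLinearMap.intervalIntegral_apply
    (Continuous.intervalIntegrable (by fun_prop) _ _)]
  have hd (t : ℝ) : HasDerivAt (fun t : ℝ => t ^ (d + 1) * g (t • x))
      ((d + 1) * (t ^ d * g (t • x)) + ((t ^ d * t) • fderiv ℝ g (t • x)) x) t := by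
    have h1 := ((hg.differentiable one_ne_zero) (t • x)).hasFDerivAt
    have h2 := h1.comp_hasDerivAt t ((hasDerivAt_id t).smul_const x)
    refine ((hasDerivAt_pow (d + 1) t).mul h2).congr_deriv ?_
    simp
    ring
  have hFTC := intervalIntegral.integral_eq_sub_of_hasDerivAt (a := 0) (b := 1)
    (fun t _ => hd t) (Continuous.intervalIntegrable (by fun_prop) _ _)
  rw [intervalIntegral.integral_add (Continuous.intervalIntegrable (by fun_prop) _ _)
    (Continuous.intervalIntegrable (by fun_prop) _ _),
    intervalIntegral.integral_const_mul] at hFTC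
  simp only [one_pow, one_smul, one_mul, ne_eq, Nat.add_eq_zero_iff, one_ne_zero, and_false,
    not_false_eq_true, zero_pow, zero_mul, sub_zero] at hFTC
  linarith

end Average

/-- The gradient of a radial function whose profile has derivative `-r h(r)`. -/
lemma hasFDerivAt_comp_norm {E : Type*} [NormedAddCommGroup E] [InnerProductSpace ℝ E]
    {u h : ℝ → ℝ} (hu : ∀ r, HasDerivAt u (-(r * h r)) r) (x : E) :
    HasFDerivAt (fun x : E => u ‖x‖) (-(h ‖x‖) • innerSL ℝ x) x := by
  by_cases hx : x = 0
  · subst hx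
    have h0 : HasDerivAt u 0 0 := by simpa using hu 0
    rw [map_zero, smul_zero, hasFDerivAt_iff_isLittleO_nhds_zero]
    have h1 := hasDerivAt_iff_isLittleO_nhds_zero.1 h0
    have h2 : Tendsto (fun y : E => ‖y‖) (𝓝 0) (𝓝 0) := by
      simpa using (continuous_norm (E := E)).tendsto 0
    refine Asymptotics.IsLittleO.of_norm_right ?_
    simpa [Function.comp_def] using h1.comp_tendsto h2
  · have hn : ‖x‖ ≠ 0 := norm_ne_zero_iff.2 hx
    have h1 : HasFDerivAt (fun x : E => ‖x‖) (‖x‖⁻¹ • innerSL ℝ x) x := by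
      have h2 := (hasStrictFDerivAt_norm_sq x).hasFDerivAt.sqrt (by positivity)
      refine (h2.congr_of_eventuallyEq ?_).congr_fderiv ?_
      · exact Eventually.of_forall fun y => (Real.sqrt_sq (norm_nonneg y)).symm
      · rw [Real.sqrt_sq (norm_nonneg x)]
        ext v
        simp
        field_simp
    refine ((hu ‖x‖).comp_hasFDerivAt x h1).congr_fderiv ?_
    rw [smul_smul]
    congr 1
    field_simp

section Laplacian

variable {d : ℕ}

lemma lapW_eq_of_uniqueDiffOn {s : Set (Euc d)} (hs : UniqueDiffOn ℝ s) {g H : Euc d → ℝ}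
    (hg : ∀ x, HasFDerivAt g (-(H x) • innerSL ℝ x) x) (hH : Differentiable ℝ H) {x : Euc d}
    (hx : x ∈ s) : lapW s g x = -(fderiv ℝ H x x + (d + 1) * H x) := by
  have hterm (i : Fin (d + 1)) :
      fderivWithin ℝ (fun y => fderivWithin ℝ g s y (EuclideanSpace.single i 1)) s x
        (EuclideanSpace.single i 1) =
      -(x i * fderiv ℝ H x (EuclideanSpace.single i 1) + H x) := by
    have hcongr : ∀ y ∈ s, fderivWithin ℝ g s y (EuclideanSpace.single i 1) = -(H y * y i) := by
      intro y hy
      rw [(hg y).hasFDerivWithinAt.fderivWithin (hs y hy)]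
      simp [EuclideanSpace.inner_single_right]
    rw [fderivWithin_congr hcongr (hcongr x hx)]
    have hp : HasFDerivAt (fun y : Euc d => y i) (EuclideanSpace.proj i : Euc d →L[ℝ] ℝ) x :=
      (EuclideanSpace.proj i : Euc d →L[ℝ] ℝ).hasFDerivAt
    have hprod : HasFDerivAt (fun y : Euc d => -(H y * y i))
        (-(H x • (EuclideanSpace.proj i : Euc d →L[ℝ] ℝ) + x i • fderiv ℝ H x)) x :=
      ((hH x).hasFDerivAt.mul hp).neg
    rw [hprod.hasFDerivWithinAt.fderivWithin (hs x hx)]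
    simp
    ring
  have hsum : ∑ i, x i * fderiv ℝ H x (EuclideanSpace.single i 1) = fderiv ℝ H x x := by
    have h := congrArg (fderiv ℝ H x) ((EuclideanSpace.basisFun (Fin (d + 1)) ℝ).sum_repr x)
    simpa using h
  unfold lapW
  rw [Finset.sum_congr rfl fun i _ => hterm i, Finset.sum_neg_distrib, Finset.sum_add_distrib, hsum]
  simp

end Laplacian

/-- A radial profile solving the integral equation yields a global classical solution. -/
lemma radial_solution_regularity {d : ℕ} {f u : ℝ → ℝ} {a : ℝ} (hf : ContDiff ℝ 1 f)
    (hu : Continuous u) (hsol : ∀ r, u r = a - radialPotential d (fun t => f (u t)) r) :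
    ContDiff ℝ 2 (fun x : Euc d => u ‖x‖) ∧
      ∀ s : Set (Euc d), UniqueDiffOn ℝ s → ∀ x ∈ s,
        lapW s (fun x : Euc d => u ‖x‖) x + f (u ‖x‖) = 0 := by
  have hud (r : ℝ) : HasDerivAt u (-(r * radialAvg d (fun t => f (u t)) r)) r :=
    hasDerivAt_radial_solution hf.continuous hu hsol r
  let ψ : Euc d → ℝ := fun x => u ‖x‖
  let H : Euc d → ℝ := fun x => ∫ τ in (0 : ℝ)..1, τ ^ d * f (ψ (τ • x))
  have hHavg (x : Euc d) : radialAvg d (fun t => f (u t)) ‖x‖ = H x := by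
    refine intervalIntegral.integral_congr fun τ hτ => ?_
    rw [uIcc_of_le zero_le_one] at hτ
    simp only [ψ, norm_smul, Real.norm_eq_abs, abs_of_nonneg hτ.1, mul_comm τ]
  have hψd (x : Euc d) : HasFDerivAt ψ (-(H x) • innerSL ℝ x) x := by
    rw [← hHavg]
    exact hasFDerivAt_comp_norm hud x
  have hψc : Continuous ψ := hu.comp continuous_norm
  have hψ1 : ContDiff ℝ 1 ψ := by
    refine contDiff_one_iff_hasFDerivAt.2 ⟨_, ?_, hψd⟩
    have hHc : Continuous H := by
      have hfc := hf.continuous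
      apply intervalIntegral.continuous_parametric_intervalIntegral_of_continuous'
      fun_prop
    exact hHc.neg.smul (innerSL ℝ).continuous
  have hH1 : ContDiff ℝ 1 H := contDiff_average d (hf.comp hψ1)
  have hψ2 : ContDiff ℝ 2 ψ := by
    rw [show (2 : WithTop ℕ∞) = 1 + 1 from by norm_num, contDiff_succ_iff_fderiv]
    refine ⟨fun x => (hψd x).differentiableAt, by simp, ?_⟩
    rw [show fderiv ℝ ψ = fun x => -(H x) • innerSL ℝ x from funext fun x => (hψd x).fderiv]
    exact hH1.neg.smul (innerSL ℝ).contDiff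
  refine ⟨hψ2, fun s hs x hx => ?_⟩
  have h1 := lapW_eq_of_uniqueDiffOn hs hψd (hH1.differentiable one_ne_zero) hx
  have h2 : fderiv ℝ H x x = f (ψ x) - (d + 1) * H x := fderiv_average_self d (hf.comp hψ1) x
  change lapW s ψ x + f (ψ x) = 0
  rw [h1, h2]
  ring

/-- Lemma 3.1: existence of a radius `R₀ > 0` and of a radially symmetric,
radially nonincreasing solution `ψ` of `Δψ + f(ψ) = 0` in the closed ball `B̄_{R₀}`, with
`0 ≤ ψ < 1`, `ψ = 0` on `∂B_{R₀}` and `max ψ = ψ(0) > θ`. -/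
theorem statement9 (d : ℕ) (hd : 1 ≤ d) (f : ℝ → ℝ) (θ : ℝ) (hf : Bistable f θ) :
    ∃ R₀ > (0 : ℝ), ∃ ψ : Euc d → ℝ,
      ContDiffOn ℝ 2 ψ (Metric.closedBall 0 R₀) ∧
      (∀ x ∈ Metric.closedBall (0 : Euc d) R₀,
        lapW (Metric.closedBall 0 R₀) ψ x + f (ψ x) = 0) ∧
      (∀ x ∈ Metric.closedBall (0 : Euc d) R₀, ψ x ∈ Ico (0 : ℝ) 1) ∧
      (∀ x ∈ Metric.sphere (0 : Euc d) R₀, ψ x = 0) ∧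
      (∀ x ∈ Metric.closedBall (0 : Euc d) R₀, ∀ y ∈ Metric.closedBall (0 : Euc d) R₀,
        ‖x‖ = ‖y‖ → ψ x = ψ y) ∧
      (∀ x ∈ Metric.closedBall (0 : Euc d) R₀, ∀ y ∈ Metric.closedBall (0 : Euc d) R₀,
        ‖x‖ ≤ ‖y‖ → ψ y ≤ ψ x) ∧
      (∀ x ∈ Metric.closedBall (0 : Euc d) R₀, ψ x ≤ ψ 0) ∧
      θ < ψ 0 := by
  obtain ⟨a, ha, u, hu, hsol, R, hR0, huR, hR⟩ := hf.exists_shooting d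
  obtain ⟨hC2, hlap⟩ := radial_solution_regularity (d := d) hf.smooth hu hsol
  have hud (r : ℝ) : HasDerivAt u (-(r * radialAvg d (fun t => f (u t)) r)) r :=
    hasDerivAt_radial_solution hf.smooth.continuous hu hsol r
  have hu0 : u 0 = a := by simp [hsol 0, radialPotential]
  have hanti : AntitoneOn u (Icc 0 R) := by
    refine antitoneOn_of_deriv_nonpos (convex_Icc _ _) hu.continuousOn
      (fun r _ => (hud r).differentiableAt.differentiableWithinAt) fun r hr => ?_
    have hr := interior_subset hr
    rw [(hud r).deriv]
    exact neg_nonpos.2 (mul_nonneg hr.1 (hR r hr).2)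
  have hmem {x : Euc d} (hx : x ∈ Metric.closedBall (0 : Euc d) R) : ‖x‖ ∈ Icc 0 R :=
    ⟨norm_nonneg x, mem_closedBall_zero_iff.1 hx⟩
  have hle {x : Euc d} (hx : x ∈ Metric.closedBall (0 : Euc d) R) : u ‖x‖ ≤ a :=
    hu0 ▸ hanti (left_mem_Icc.2 hR0.le) (hmem hx) (norm_nonneg x)
  have huniq : UniqueDiffOn ℝ (Metric.closedBall (0 : Euc d) R) :=
    uniqueDiffOn_convex (convex_closedBall _ _)
      ⟨0, Metric.ball_subset_interior_closedBall (Metric.mem_ball_self hR0)⟩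
  refine ⟨R, hR0, fun x => u ‖x‖, hC2.contDiffOn, hlap _ huniq,
    fun x hx => ⟨(hR _ (hmem hx)).1, (hle hx).trans_lt ha.2⟩, fun x hx => ?_,
    fun x _ y _ hxy => by simp only [hxy],
    fun x hx y hy hxy => hanti (hmem hx) (hmem hy) hxy, fun x hx => ?_, ?_⟩
  · simp only [mem_sphere_zero_iff_norm.1 hx, huR]
  · simpa only [norm_zero, hu0] using hle hx
  · simpa only [norm_zero, hu0] using ha.1
end
end
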